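/- arXiv:2605.31453 — 13 statements merged into one kernel-verified Lean document; each statement's English description precedes it below -/
import Mathlib

section
/- Let G be a claw-free finite simple graph, let ℓ₁–ℓ₂–⋯–ℓ_n be an induced path in G with n ≥ 2, and let j be a vertex of G not on the path. Let T(j) = {ℓ_i : j is adjacent to ℓ_i} and assume |T(j)| is odd. Then, after possibly reversing the listing of the path, exactly one of the following three alternatives holds: (i) T(j) = {ℓ_n} (j is adjacent only to the terminal vertex); (ii) T(j) = {ℓ_{k−1}, ℓ_k, ℓ_{k+1}} for some 2 ≤ k ≤ n−1 (three consecutive path vertices); (iii) T(j) = {ℓ_{k−1}, ℓ_k, ℓ_n} for some 2 ≤ k < n−1 (two consecutive vertices together with the terminal vertex, with no adjacency to ℓ_{k+1},…,ℓ_{n−1}). Moreover, for a fixed listing, the set of vertices j with T(j) = {ℓ_n}, together with ℓ_n itself, forms a clique. -/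
/-- A graph is claw-free if it contains no induced `K_{1,3}`. -/
def ClawFree {V : Type*} (G : SimpleGraph V) : Prop :=
  ¬ ∃ c a b d : V, a ≠ b ∧ a ≠ d ∧ b ≠ d ∧
    G.Adj c a ∧ G.Adj c b ∧ G.Adj c d ∧
    ¬ G.Adj a b ∧ ¬ G.Adj a d ∧ ¬ G.Adj b d

/-- `ℓ 0, ℓ 1, …, ℓ (m-1)` is an induced path in `G`. -/
def IsInducedPath {V : Type*} (G : SimpleGraph V) (m : ℕ) (ℓ : ℕ → V) : Prop :=
  (∀ a b, a < m → b < m → ℓ a = ℓ b → a = b) ∧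
  ∀ a b, a < m → b < m → (G.Adj (ℓ a) (ℓ b) ↔ (a + 1 = b ∨ b + 1 = a))

/-- The set of indices `a < n` of path vertices `ℓ a` adjacent to `j`. -/
def touchSet {V : Type*} (G : SimpleGraph V) [DecidableRel G.Adj]
    (n : ℕ) (ℓ : ℕ → V) (j : V) : Finset ℕ :=
  (Finset.range n).filter (fun a => G.Adj j (ℓ a))

/-- Alternative (i): `j` is adjacent only to the terminal vertex `ℓ (n-1)`. -/
def AltI {V : Type*} (G : SimpleGraph V) [DecidableRel G.Adj]
    (n : ℕ) (ℓ : ℕ → V) (j : V) : Prop :=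
  touchSet G n ℓ j = {n - 1}

/-- Alternative (ii): `j` is adjacent to precisely three consecutive path vertices. -/
def AltII {V : Type*} (G : SimpleGraph V) [DecidableRel G.Adj]
    (n : ℕ) (ℓ : ℕ → V) (j : V) : Prop :=
  ∃ k, 1 ≤ k ∧ k + 2 ≤ n ∧ touchSet G n ℓ j = {k - 1, k, k + 1}

/-- Alternative (iii): `j` is adjacent to two consecutive path vertices and to the
terminal vertex, with a gap in between. -/
def AltIII {V : Type*} (G : SimpleGraph V) [DecidableRel G.Adj]
    (n : ℕ) (ℓ : ℕ → V) (j : V) : Prop :=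
  ∃ k, 1 ≤ k ∧ k + 3 ≤ n ∧ touchSet G n ℓ j = {k - 1, k, n - 1}

section Helpers

variable {V : Type*} {G : SimpleGraph V} {n : ℕ} {ℓ : ℕ → V} {j : V}

theorem IsInducedPath.reverse (h : IsInducedPath G n ℓ) :
    IsInducedPath G n (fun a => ℓ (n - 1 - a)) := by
  refine ⟨fun a b ha hb hab => ?_, fun a b ha hb => ?_⟩
  · have := h.1 _ _ (by omega) (by omega) hab
    omega
  · rw [h.2 _ _ (by omega) (by omega)]
    omega

variable [DecidableRel G.Adj]

theorem mem_touchSet {a : ℕ} : a ∈ touchSet G n ℓ j ↔ a < n ∧ G.Adj j (ℓ a) := by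
  simp [touchSet]

/-- The touch set with respect to the reversed path is the reflected touch set. -/
theorem mem_touchSet_reverse {a : ℕ} (ha : a < n) :
    a ∈ touchSet G n (fun b => ℓ (n - 1 - b)) j ↔ n - 1 - a ∈ touchSet G n ℓ j := by
  simp only [mem_touchSet]
  exact and_congr_left fun _ => by omega

/-- An interior path vertex adjacent to `j` has a path-neighbour adjacent to `j`. -/
theorem touchSet_not_isolated (hG : ClawFree G) (hpath : IsInducedPath G n ℓ)
    (hj : ∀ a, a < n → j ≠ ℓ a) {a : ℕ} (ha : a + 2 < n)
    (h : a + 1 ∈ touchSet G n ℓ j) : a ∈ touchSet G n ℓ j ∨ a + 2 ∈ touchSet G n ℓ j := by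
  by_contra! hc
  simp only [mem_touchSet] at h hc
  refine hG ⟨ℓ (a + 1), j, ℓ a, ℓ (a + 2), hj _ (by omega), hj _ (by omega), fun he => ?_,
    h.2.symm, ?_, ?_, fun he => hc.1 ⟨by omega, he⟩, fun he => hc.2 ⟨by omega, he⟩, ?_⟩
  · have := hpath.1 _ _ (by omega) (by omega) he
    omega
  all_goals rw [hpath.2 _ _ (by omega) (by omega)]; omega

/-- No three pairwise non-consecutive path vertices are adjacent to `j`. -/
theorem touchSet_not_three_spread (hG : ClawFree G) (hpath : IsInducedPath G n ℓ)
    {a b c : ℕ} (ha : a ∈ touchSet G n ℓ j) (hb : b ∈ touchSet G n ℓ j)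
    (hc : c ∈ touchSet G n ℓ j) (hab : a + 1 < b) (hbc : b + 1 < c) : False := by
  simp only [mem_touchSet] at ha hb hc
  refine hG ⟨j, ℓ a, ℓ b, ℓ c, fun he => ?_, fun he => ?_, fun he => ?_,
    ha.2, hb.2, hc.2, ?_, ?_, ?_⟩
  iterate 3
    have := hpath.1 _ _ (by omega) (by omega) he
    omega
  all_goals rw [hpath.2 _ _ (by omega) (by omega)]; omega

theorem touchSet_card_le_four (hG : ClawFree G) (hpath : IsInducedPath G n ℓ) :
    (touchSet G n ℓ j).card ≤ 4 := by
  by_contra! h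
  let f := (touchSet G n ℓ j).orderEmbOfFin rfl
  have hf (i) : f i ∈ touchSet G n ℓ j := Finset.orderEmbOfFin_mem _ _ _
  have hlt (i : ℕ) (hi : i + 1 < (touchSet G n ℓ j).card) :
      f ⟨i, by omega⟩ < f ⟨i + 1, hi⟩ := f.strictMono (by simp)
  have h0 : f ⟨0, by omega⟩ < f ⟨1, by omega⟩ := hlt 0 _
  have h1 : f ⟨1, by omega⟩ < f ⟨2, by omega⟩ := hlt 1 _
  have h2 : f ⟨2, by omega⟩ < f ⟨3, by omega⟩ := hlt 2 _
  have h3 : f ⟨3, by omega⟩ < f ⟨4, by omega⟩ := hlt 3 _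
  exact touchSet_not_three_spread hG hpath (hf ⟨0, by omega⟩) (hf ⟨2, by omega⟩)
    (hf ⟨4, by omega⟩) (by omega) (by omega)

theorem touchSet_eq_triple (h : (touchSet G n ℓ j).card = 3) :
    ∃ a b c, a < b ∧ b < c ∧ touchSet G n ℓ j = {a, b, c} := by
  let f := (touchSet G n ℓ j).orderEmbOfFin h
  have h01 : f 0 < f 1 := f.strictMono (by decide)
  have h12 : f 1 < f 2 := f.strictMono (by decide)
  refine ⟨f 0, f 1, f 2, h01, h12, (Finset.eq_of_subset_of_card_le ?_ ?_).symm⟩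
  · simp [Finset.insert_subset_iff, f, Finset.orderEmbOfFin_mem]
  · rw [h, Finset.card_eq_three.2 ⟨_, _, _, h01.ne, (h01.trans h12).ne, h12.ne, rfl⟩]

/-- The alternatives, up to reversal of the path. -/
theorem alternatives_or_reverse (hG : ClawFree G) (hpath : IsInducedPath G n ℓ)
    (hj : ∀ a, a < n → j ≠ ℓ a) (hodd : Odd (touchSet G n ℓ j).card) :
    (AltI G n ℓ j ∨ AltII G n ℓ j ∨ AltIII G n ℓ j) ∨
      (AltI G n (fun a => ℓ (n - 1 - a)) j ∨ AltIII G n (fun a => ℓ (n - 1 - a)) j) := by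
  have hle := touchSet_card_le_four (j := j) hG hpath
  have hlt (a) (ha : a ∈ touchSet G n ℓ j) : a < n := (mem_touchSet.1 ha).1
  have hrev (a) (ha : a < n) := mem_touchSet_reverse (G := G) (ℓ := ℓ) (j := j) ha
  have hrevlt (a) (ha : a ∈ touchSet G n (fun b => ℓ (n - 1 - b)) j) : a < n :=
    (mem_touchSet.1 ha).1
  have hiso (a) (h : a ∈ touchSet G n ℓ j) :
      a = 0 ∨ n ≤ a + 1 ∨ a - 1 ∈ touchSet G n ℓ j ∨ a + 1 ∈ touchSet G n ℓ j := by
    rcases a with _ | a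
    · exact .inl rfl
    · rcases le_or_gt n (a + 2) with han | han
      · exact .inr (.inl han)
      · exact .inr (.inr (touchSet_not_isolated hG hpath hj han h))
  have hcard : (touchSet G n ℓ j).card = 1 ∨ (touchSet G n ℓ j).card = 3 := by
    obtain ⟨m, hm⟩ := hodd
    omega
  rcases hcard with h | h
  · obtain ⟨a, h⟩ := Finset.card_eq_one.1 h
    have han := hlt a (by simp [h])
    have ha := hiso a (by simp [h])
    simp only [h, Finset.mem_singleton] at ha hrev
    rcases Nat.eq_zero_or_pos a with rfl | hpos
    · refine .inr (.inl ?_)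
      ext x
      rw [Finset.mem_singleton]
      refine ⟨fun hx => ?_, fun hx => (hrev x (by omega)).2 (by omega)⟩
      have := hrevlt x hx
      have := (hrev x this).1 hx
      omega
    · refine .inl (.inl ?_)
      rw [AltI, h]
      congr 1
      omega
  · obtain ⟨a, b, c, hab, hbc, h⟩ := touchSet_eq_triple h
    have hcn := hlt c (by simp [h])
    have hspread : b ≤ a + 1 ∨ c ≤ b + 1 := by
      by_contra! hcon
      exact touchSet_not_three_spread (j := j) hG hpath (a := a) (b := b) (c := c)
        (by simp [h]) (by simp [h]) (by simp [h]) hcon.1 hcon.2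
    have ha := hiso a (by simp [h])
    have hc := hiso c (by simp [h])
    simp only [h, Finset.mem_singleton, Finset.mem_insert] at ha hc hrev
    by_cases hb : b = a + 1
    · by_cases hc' : c = b + 1
      · exact .inl (.inr (.inl ⟨b, by omega, by omega, by rw [h, hb, hc', hb]; rfl⟩))
      · refine .inl (.inr (.inr ⟨b, by omega, by omega, ?_⟩))
        rw [h, hb, show c = n - 1 by omega]
        rfl
    · refine .inr (.inr ⟨n - 1 - b, by omega, by omega, ?_⟩)
      ext x
      simp only [Finset.mem_insert, Finset.mem_singleton]
      refine ⟨fun hx => ?_, fun hx => (hrev x (by omega)).2 (by omega)⟩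
      have := hrevlt x hx
      have := (hrev x this).1 hx
      omega

theorem AltI.not_altII (h : AltI G n ℓ j) : ¬ AltII G n ℓ j := by
  rintro ⟨k, h1, h2, h3⟩
  have := Finset.ext_iff.1 (h.symm.trans h3) k
  simp at this
  omega

theorem AltI.not_altIII (h : AltI G n ℓ j) : ¬ AltIII G n ℓ j := by
  rintro ⟨k, h1, h2, h3⟩
  have := Finset.ext_iff.1 (h.symm.trans h3) k
  simp at this
  omega

theorem AltII.not_altIII (h : AltII G n ℓ j) : ¬ AltIII G n ℓ j := by
  obtain ⟨k, h1, h2, h3⟩ := h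
  rintro ⟨m, h4, h5, h6⟩
  have h7 := Finset.ext_iff.1 (h3.symm.trans h6)
  simp only [Finset.mem_insert, Finset.mem_singleton] at h7
  have := h7 (m - 1)
  have := h7 m
  have := h7 (n - 1)
  omega

theorem exactly_one_alternative (h : AltI G n ℓ j ∨ AltII G n ℓ j ∨ AltIII G n ℓ j) :
    (AltI G n ℓ j ∧ ¬ AltII G n ℓ j ∧ ¬ AltIII G n ℓ j) ∨
      (¬ AltI G n ℓ j ∧ AltII G n ℓ j ∧ ¬ AltIII G n ℓ j) ∨
      (¬ AltI G n ℓ j ∧ ¬ AltII G n ℓ j ∧ AltIII G n ℓ j) := by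
  have h12 := AltI.not_altII (G := G) (n := n) (ℓ := ℓ) (j := j)
  have h13 := AltI.not_altIII (G := G) (n := n) (ℓ := ℓ) (j := j)
  have h23 := AltII.not_altIII (G := G) (n := n) (ℓ := ℓ) (j := j)
  tauto

/-- Two distinct off-path vertices whose only path-neighbour is the terminal vertex are
adjacent. -/
theorem adj_of_touchSet_eq_terminal (hG : ClawFree G) (hn : 2 ≤ n)
    (hpath : IsInducedPath G n ℓ) {x y : V}
    (hx : ∀ a, a < n → x ≠ ℓ a) (hxt : touchSet G n ℓ x = {n - 1})
    (hy : ∀ a, a < n → y ≠ ℓ a) (hyt : touchSet G n ℓ y = {n - 1}) (hxy : x ≠ y) :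
    G.Adj x y := by
  have adj_iff {z} (hz : touchSet G n ℓ z = {n - 1}) (a) (ha : a < n) :
      G.Adj z (ℓ a) ↔ a = n - 1 := by
    rw [← Finset.mem_singleton, ← hz, mem_touchSet, and_iff_right ha]
  by_contra hadj
  refine hG ⟨ℓ (n - 1), x, y, ℓ (n - 2), hxy, hx _ (by omega), hy _ (by omega),
    ((adj_iff hxt _ (by omega)).2 rfl).symm, ((adj_iff hyt _ (by omega)).2 rfl).symm, ?_,
    hadj, ?_, ?_⟩
  · rw [hpath.2 _ _ (by omega) (by omega)]
    omega
  · rw [adj_iff hxt _ (by omega)]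
    omega
  · rw [adj_iff hyt _ (by omega)]
    omega

end Helpers

/-- Classification of off-path vertices with an odd number of path-neighbours on an
induced path of a claw-free graph; moreover the terminal-extension vertices together
with the terminal vertex form a clique. -/
theorem stmt_2 {V : Type*} [Fintype V] (G : SimpleGraph V) [DecidableRel G.Adj]
    (hG : ClawFree G)
    (n : ℕ) (hn : 2 ≤ n) (ℓ : ℕ → V) (hpath : IsInducedPath G n ℓ)
    (j : V) (hj : ∀ a, a < n → j ≠ ℓ a)
    (hodd : Odd (touchSet G n ℓ j).card) :
    (∃ ℓ' : ℕ → V,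
      ((∀ a, a < n → ℓ' a = ℓ a) ∨ (∀ a, a < n → ℓ' a = ℓ (n - 1 - a))) ∧
      IsInducedPath G n ℓ' ∧
      ((AltI G n ℓ' j ∧ ¬ AltII G n ℓ' j ∧ ¬ AltIII G n ℓ' j) ∨
       (¬ AltI G n ℓ' j ∧ AltII G n ℓ' j ∧ ¬ AltIII G n ℓ' j) ∨
       (¬ AltI G n ℓ' j ∧ ¬ AltII G n ℓ' j ∧ AltIII G n ℓ' j))) ∧
    (∀ x y : V,
      (x = ℓ (n - 1) ∨ ((∀ a, a < n → x ≠ ℓ a) ∧ touchSet G n ℓ x = {n - 1})) →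
      (y = ℓ (n - 1) ∨ ((∀ a, a < n → y ≠ ℓ a) ∧ touchSet G n ℓ y = {n - 1})) →
      x ≠ y → G.Adj x y) := by
  refine ⟨?_, fun x y hx hy hxy => ?_⟩
  · rcases alternatives_or_reverse hG hpath hj hodd with h | h
    · exact ⟨ℓ, .inl fun _ _ => rfl, hpath, exactly_one_alternative h⟩
    · exact ⟨_, .inr fun _ _ => rfl, hpath.reverse,
        exactly_one_alternative (h.imp_right Or.inr)⟩
  · have terminal_adj {z} (hz : touchSet G n ℓ z = {n - 1}) : G.Adj z (ℓ (n - 1)) :=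
      (mem_touchSet.1 (hz ▸ Finset.mem_singleton_self (n - 1))).2
    rcases hx with rfl | ⟨hx, hxt⟩ <;> rcases hy with rfl | ⟨hy, hyt⟩
    · exact absurd rfl hxy
    · exact (terminal_adj hyt).symm
    · exact terminal_adj hxt
    · exact adj_of_touchSet_eq_terminal hG hn hpath hx hxt hy hyt hxy
end

section
/- Let G be a claw-free finite simple graph, let L = ℓ₁–ℓ₂–⋯–ℓ_m be an induced path in G, and let j be a vertex not on the path whose neighbours among the path vertices are exactly ℓ_{k−1}, ℓ_k, ℓ_{k+1} for some 2 ≤ k ≤ m−1. Then the sequence L′ = ℓ₁–⋯–ℓ_{k−1}–j–ℓ_{k+1}–⋯–ℓ_m obtained by replacing ℓ_k with j is again an induced path, and the closed neighborhoods of the two vertex sets coincide: Γ[L] = Γ[L′]. -/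
/-- In a claw-free graph, the closed neighbourhood of a vertex is covered by those of any two of
its nonadjacent neighbours. -/
theorem ClawFree.mem_closedNeighborhood_of_adj {V : Type*} {G : SimpleGraph V} (hG : ClawFree G)
    {c p q x : V} (hcp : G.Adj c p) (hcq : G.Adj c q) (hpq : p ≠ q) (hnpq : ¬ G.Adj p q)
    (hx : x = c ∨ G.Adj x c) : (x = p ∨ G.Adj x p) ∨ (x = q ∨ G.Adj x q) := by
  rcases hx with rfl | hx
  · exact .inl (.inr hcp)
  · by_contra! h
    obtain ⟨⟨hxp, hnxp⟩, hxq, hnxq⟩ := h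
    exact hG ⟨c, x, p, q, hxp, hxq, hpq, hx.symm, hcp, hcq, hnxp, hnxq, hnpq⟩

/-- Three-neighbour replacement: if the neighbours of the off-path vertex `j` among
the path vertices are exactly `ℓ (k-1), ℓ k, ℓ (k+1)`, then replacing `ℓ k` by `j`
again yields an induced path with the same union of closed neighborhoods. -/
theorem stmt_4 {V : Type*} [Fintype V] (G : SimpleGraph V) (hG : ClawFree G)
    (m : ℕ) (ℓ : ℕ → V) (hpath : IsInducedPath G m ℓ)
    (j : V) (hj : ∀ a, a < m → j ≠ ℓ a)
    (k : ℕ) (hk1 : 1 ≤ k) (hk2 : k + 1 < m)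
    (hnbr : ∀ a, a < m → (G.Adj j (ℓ a) ↔ (a = k - 1 ∨ a = k ∨ a = k + 1))) :
    IsInducedPath G m (fun a => if a = k then j else ℓ a) ∧
    (∀ x : V,
      (∃ a, a < m ∧ (x = ℓ a ∨ G.Adj x (ℓ a))) ↔
      (∃ a, a < m ∧
        (x = (if a = k then j else ℓ a) ∨ G.Adj x (if a = k then j else ℓ a)))) := by
  obtain ⟨hinj, hadj⟩ := hpath
  refine ⟨⟨fun a b ha hb => ?_, fun a b ha hb => ?_⟩, fun x => ?_⟩
  · have := hinj a b ha hb
    have := hj a ha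
    have := hj b hb
    grind
  · have := hadj a b ha hb
    have := hnbr a ha
    have := hnbr b hb
    have := G.adj_comm j (ℓ a)
    have := G.loopless.irrefl j
    grind
  · have hp : k - 1 < m := by omega
    have hkm : k < m := by omega
    have hpq : ℓ (k - 1) ≠ ℓ (k + 1) := fun h => by
      have := hinj _ _ hp hk2 h
      omega
    have hnpq : ¬ G.Adj (ℓ (k - 1)) (ℓ (k + 1)) := by
      rw [hadj _ _ hp hk2]
      omega
    have hpk : k - 1 ≠ k := by omega
    have hqk : k + 1 ≠ k := by omega
    constructor
    · rintro ⟨a, ha, hx⟩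
      by_cases hak : a = k
      · subst hak
        rcases hG.mem_closedNeighborhood_of_adj ((hadj _ _ ha hp).2 (by omega))
          ((hadj _ _ ha hk2).2 (by omega)) hpq hnpq hx with h | h
        · exact ⟨a - 1, hp, by simpa only [if_neg hpk] using h⟩
        · exact ⟨a + 1, hk2, by simpa only [if_neg hqk] using h⟩
      · exact ⟨a, ha, by simpa only [if_neg hak] using hx⟩
    · rintro ⟨a, ha, hx⟩
      by_cases hak : a = k
      · rw [if_pos hak] at hx
        rcases hG.mem_closedNeighborhood_of_adj ((hnbr _ hp).2 (by omega))
          ((hnbr _ hk2).2 (by omega)) hpq hnpq hx with h | h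
        · exact ⟨k - 1, hp, h⟩
        · exact ⟨k + 1, hk2, h⟩
      · exact ⟨a, ha, by simpa only [if_neg hak] using hx⟩
end

section
/- Let G be a finite simple graph that is even-hole-free and claw-free, let L = ℓ₀–ℓ₁–⋯–ℓ_n be an induced path in G, and let j be a vertex not on the path whose neighbours among the path vertices are exactly ℓ_{k−1}, ℓ_k and ℓ_n, for some k with 1 ≤ k ≤ n−2. Then: (a) the cycle ℓ_k–ℓ_{k+1}–⋯–ℓ_n–j–ℓ_k is an induced cycle; (b) this cycle has an odd number of vertices, i.e. n − k is odd; (c) the sequence L′ = ℓ₀–⋯–ℓ_{k−1}–j–ℓ_n–ℓ_{n−1}–⋯–ℓ_{k+1} is an induced path; (d) the closed neighborhoods of the vertex sets of L and L′ coincide: Γ[L] = Γ[L′]. -/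
/-- `c 0, c 1, …, c (q-1)` is an induced cycle in `G`: at least three distinct
vertices, adjacent iff cyclically consecutive. -/
def IsInducedCycle {V : Type*} (G : SimpleGraph V) (q : ℕ) (c : ℕ → V) : Prop :=
  3 ≤ q ∧
  (∀ a b, a < q → b < q → c a = c b → a = b) ∧
  ∀ a b, a < q → b < q → (G.Adj (c a) (c b) ↔ ((a + 1) % q = b ∨ (b + 1) % q = a))

/-- A graph is even-hole-free if it contains no induced cycle with an even number of
vertices. -/
def EvenHoleFree {V : Type*} (G : SimpleGraph V) : Prop :=
  ¬ ∃ (q : ℕ) (c : ℕ → V), Even q ∧ IsInducedCycle G q c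

/-- Loop pairing: if the neighbours of an off-path vertex `j` among the vertices of
the induced path `ℓ 0 – ⋯ – ℓ n` are exactly `ℓ (k-1)`, `ℓ k` and `ℓ n`, then
(a) `ℓ k – ℓ (k+1) – ⋯ – ℓ n – j` is an induced cycle; (b) this cycle is odd, i.e.
`n - k` is odd; (c) the path obtained by replacing `ℓ k` with `j` and reversing the
tail is induced; (d) the two paths have the same union of closed neighborhoods. -/
theorem stmt_5 {V : Type*} [Fintype V] (G : SimpleGraph V)
    (hehf : EvenHoleFree G) (hcf : ClawFree G)
    (n : ℕ) (ℓ : ℕ → V) (hpath : IsInducedPath G (n + 1) ℓ)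
    (j : V) (hj : ∀ a, a < n + 1 → j ≠ ℓ a)
    (k : ℕ) (hk1 : 1 ≤ k) (hk2 : k + 2 ≤ n)
    (hnbr : ∀ a, a < n + 1 → (G.Adj j (ℓ a) ↔ (a = k - 1 ∨ a = k ∨ a = n))) :
    IsInducedCycle G (n - k + 2) (fun a => if a ≤ n - k then ℓ (k + a) else j) ∧
    Odd (n - k) ∧
    IsInducedPath G (n + 1)
      (fun a => if a < k then ℓ a else if a = k then j else ℓ (n + k + 1 - a)) ∧
    (∀ x : V,
      (∃ a, a < n + 1 ∧ (x = ℓ a ∨ G.Adj x (ℓ a))) ↔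
      (∃ a, a < n + 1 ∧
        (x = (if a < k then ℓ a else if a = k then j else ℓ (n + k + 1 - a)) ∨
         G.Adj x (if a < k then ℓ a else if a = k then j else ℓ (n + k + 1 - a))))) := by
  have hcyc : IsInducedCycle G (n - k + 2) (fun a => if a ≤ n - k then ℓ (k + a) else j) := by
    have hmod : ∀ a b, a < n - k + 2 → b < n - k + 2 →
        ((a + 1) % (n - k + 2) = b ↔ (a + 1 = b ∨ (a = n - k + 1 ∧ b = 0))) := by
      intro a b ha hb
      rcases Nat.lt_or_ge (a + 1) (n - k + 2) with h | h
      · rw [Nat.mod_eq_of_lt h]; omega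
      · obtain rfl : a = n - k + 1 := by omega
        rw [Nat.mod_self]; omega
    refine ⟨by omega, ?_, ?_⟩
    · intro a b ha hb hab
      dsimp only at hab
      split_ifs at hab with h1 h2 h2
      · have := hpath.1 _ _ (by omega) (by omega) hab
        omega
      · exact absurd hab.symm (hj _ (by omega))
      · exact absurd hab (hj _ (by omega))
      · omega
    · intro a b ha hb
      rw [hmod a b ha hb, hmod b a hb ha]
      dsimp only
      split_ifs with h1 h2 h2
      · rw [hpath.2 _ _ (by omega) (by omega)]; omega
      · rw [G.adj_comm, hnbr _ (by omega)]; omega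
      · rw [hnbr _ (by omega)]; omega
      · simp only [SimpleGraph.irrefl, false_iff]; omega
  refine ⟨hcyc, ?_, ⟨?_, ?_⟩, ?_⟩
  · by_contra h
    rw [Nat.not_odd_iff_even] at h
    exact hehf ⟨_, _, h.add even_two, hcyc⟩
  · intro a b ha hb hab
    dsimp only at hab
    split_ifs at hab
    all_goals first
      | omega
      | exact absurd hab (hj _ (by omega))
      | exact absurd hab.symm (hj _ (by omega))
      | (have := hpath.1 _ _ (by omega) (by omega) hab
         omega)
  · intro a b ha hb
    dsimp only
    split_ifs
    all_goals first
      | exact hpath.2 _ _ ha hb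
      | (rw [hpath.2 _ _ (by omega) (by omega)]; omega)
      | (rw [hnbr _ (by omega)]; omega)
      | (rw [G.adj_comm, hnbr _ (by omega)]; omega)
      | (simp only [SimpleGraph.irrefl, false_iff]; omega)
  · have hreroute : ∀ P : V → Prop,
        (∃ a, a < n + 1 ∧ P (if a < k then ℓ a else if a = k then j else ℓ (n + k + 1 - a))) ↔
          P j ∨ ∃ a, a < n + 1 ∧ a ≠ k ∧ P (ℓ a) := by
      intro P
      constructor
      · rintro ⟨a, ha, h⟩
        split_ifs at h with h1 h2
        · exact Or.inr ⟨a, ha, by omega, h⟩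
        · exact Or.inl h
        · exact Or.inr ⟨n + k + 1 - a, by omega, by omega, h⟩
      · rintro (h | ⟨a, ha, hak, h⟩)
        · exact ⟨k, by omega, by simpa using h⟩
        · rcases Nat.lt_or_ge a k with h1 | h1
          · exact ⟨a, ha, by simpa [h1] using h⟩
          · refine ⟨n + k + 1 - a, by omega, ?_⟩
            rw [if_neg (by omega), if_neg (by omega),
              show n + k + 1 - (n + k + 1 - a) = a by omega]
            exact h
    intro x
    rw [hreroute fun v => x = v ∨ G.Adj x v]
    constructor
    · rintro ⟨a, ha, h⟩
      by_cases hak : a = k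
      · subst hak
        by_contra! hx
        have hpred := hx.2 (a - 1) (by omega) (by omega)
        have hsucc := hx.2 (a + 1) (by omega) (by omega)
        have hadj : G.Adj (ℓ a) (ℓ (a - 1)) := (hpath.2 _ _ ha (by omega)).2 (by omega)
        rcases h with rfl | h
        · exact hpred.2 hadj
        · refine hcf ⟨ℓ a, x, ℓ (a - 1), ℓ (a + 1), hpred.1, hsucc.1, fun he => ?_, h.symm, hadj,
            (hpath.2 _ _ ha (by omega)).2 (by omega), hpred.2, hsucc.2, fun he => ?_⟩
          · have := hpath.1 _ _ (by omega) (by omega) he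
            omega
          · have := (hpath.2 _ _ (by omega) (by omega)).1 he
            omega
      · exact Or.inr ⟨a, ha, hak, h⟩
    · rintro (h | ⟨a, ha, -, h⟩)
      · by_contra! hx
        have hpred := hx (k - 1) (by omega)
        have hlast := hx n (by omega)
        have hadj : G.Adj j (ℓ (k - 1)) := (hnbr _ (by omega)).2 (by omega)
        rcases h with rfl | h
        · exact hpred.2 hadj
        · refine hcf ⟨j, x, ℓ (k - 1), ℓ n, hpred.1, hlast.1, fun he => ?_, h.symm, hadj,
            (hnbr _ (by omega)).2 (by omega), hpred.2, hlast.2, fun he => ?_⟩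
          · have := hpath.1 _ _ (by omega) (by omega) he
            omega
          · have := (hpath.2 _ _ (by omega) (by omega)).1 he
            omega
      · exact ⟨a, ha, h⟩
end

section
/- Let G be a finite simple graph, let ρ = ℓ₁–⋯–ℓ_m be an induced path in G with m odd, and let j be a vertex not on ρ whose neighbours among the path vertices are exactly ℓ_{q−1}, ℓ_q and ℓ_m, for some q with 2 ≤ q < m−1. Then C = ℓ_q–ℓ_{q+1}–⋯–ℓ_m–j–ℓ_q is an induced cycle with m − q + 2 vertices. If this cycle has an even number of vertices, then q ≥ 3, the remaining path segment ℓ₁–⋯–ℓ_{q−1} has at least two vertices, its last vertex ℓ_{q−1} is adjacent to exactly the two consecutive cycle vertices ℓ_q and j and to no other cycle vertex, every earlier segment vertex is adjacent to no cycle vertex (so the cycle and the segment form an even bubble wand), and the hole size satisfies m − q + 2 ≤ m − 1. -/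
theorem succ_mod_eq_iff {n a b : ℕ} (ha : a < n) (hb : b < n) :
    (a + 1) % n = b ↔ (a + 1 = b ∨ a + 1 = n ∧ b = 0) := by
  rcases Nat.lt_or_ge (a + 1) n with h | h
  · rw [Nat.mod_eq_of_lt h]; omega
  · obtain rfl : a + 1 = n := by omega
    rw [Nat.mod_self]; omega

/-- Endpoint loop on an odd induced path (0-indexed: `ℓ 0 – ⋯ – ℓ (m-1)`, `m` odd,
`j` adjacent exactly to `ℓ (q-1), ℓ q, ℓ (m-1)` with `1 ≤ q`, `q + 2 < m`):
the cycle `ℓ q – ⋯ – ℓ (m-1) – j` is induced with `m + 1 - q` vertices, and if this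
number is even, then `q ≥ 2`, the segment `ℓ 0 – ⋯ – ℓ (q-1)` together with the cycle
forms an even bubble wand (its last vertex `ℓ (q-1)` is adjacent exactly to the
consecutive cycle vertices `ℓ q` and `j`, the earlier segment vertices to no cycle
vertex), and the hole size satisfies `m + 1 - q ≤ m - 1`. -/
theorem stmt_6 {V : Type*} [Fintype V] (G : SimpleGraph V)
    (m : ℕ) (hm : Odd m) (ℓ : ℕ → V) (hpath : IsInducedPath G m ℓ)
    (j : V) (hj : ∀ a, a < m → j ≠ ℓ a)
    (q : ℕ) (hq1 : 1 ≤ q) (hq2 : q + 2 < m)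
    (hnbr : ∀ a, a < m → (G.Adj j (ℓ a) ↔ (a = q - 1 ∨ a = q ∨ a = m - 1))) :
    IsInducedCycle G (m + 1 - q) (fun a => if a ≤ m - 1 - q then ℓ (q + a) else j) ∧
    (Even (m + 1 - q) →
      2 ≤ q ∧
      G.Adj (ℓ (q - 1)) (ℓ q) ∧
      G.Adj (ℓ (q - 1)) j ∧
      (∀ b, q ≤ b → b < m → G.Adj (ℓ (q - 1)) (ℓ b) → b = q) ∧
      (∀ a, a + 1 < q →
        (∀ b, q ≤ b → b < m → ¬ G.Adj (ℓ a) (ℓ b)) ∧ ¬ G.Adj (ℓ a) j) ∧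
      m + 1 - q ≤ m - 1) := by
  obtain ⟨hinj, hadj⟩ := hpath
  refine ⟨⟨by omega, ?_, ?_⟩, ?_⟩
  · intro a b ha hb hab
    dsimp only at hab
    split_ifs at hab with h₁ h₂ h₂
    · have := hinj _ _ (by omega) (by omega) hab
      omega
    · exact absurd hab.symm (hj _ (by omega))
    · exact absurd hab (hj _ (by omega))
    · omega
  · intro a b ha hb
    rw [succ_mod_eq_iff ha hb, succ_mod_eq_iff hb ha]
    dsimp only
    split_ifs with h₁ h₂ h₂
    · rw [hadj _ _ (by omega) (by omega)]
      omega
    · rw [G.adj_comm, hnbr _ (by omega)]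
      omega
    · rw [hnbr _ (by omega)]
      omega
    · simp only [G.irrefl, false_iff]
      omega
  · intro heven
    have hq : 2 ≤ q := by
      obtain ⟨k, hk⟩ := hm
      obtain ⟨r, hr⟩ := heven
      omega
    refine ⟨hq, ?_, ?_, ?_, ?_, by omega⟩
    · rw [hadj _ _ (by omega) (by omega)]
      omega
    · rw [G.adj_comm, hnbr _ (by omega)]
      omega
    · intro b hqb hbm hb
      rw [hadj _ _ (by omega) hbm] at hb
      omega
    · refine fun a ha => ⟨fun b hqb hbm => ?_, ?_⟩
      · rw [hadj _ _ (by omega) hbm]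
        omega
      · rw [G.adj_comm, hnbr _ (by omega)]
        omega
end

section
/- Let G be a claw-free finite simple graph and let L₁,…,L_c (c ≥ 2) be induced paths in G that are pairwise vertex-disjoint with no edge of G joining two distinct paths. Let j be a vertex of G lying on none of the paths, such that the total number of neighbours of j on the union of the paths is odd, and such that j has a neighbour in at least two of the paths. Then j has neighbours in exactly two of the paths; in one of these two paths j is adjacent to exactly two vertices, which are consecutive along that path, and in the other path j is adjacent to exactly one vertex, which is an endpoint of that path. -/
/-- In a claw-free graph, let `j` be a vertex off an induced path, having a neighbour on the path
and a neighbour `x` anticomplete to the path. Then the neighbours of `j` on the path are either two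
consecutive vertices or a single endpoint. -/
theorem ClawFree.neighbors_on_inducedPath {V : Type*} {G : SimpleGraph V} (hG : ClawFree G)
    {m : ℕ} {p : ℕ → V} (hp : IsInducedPath G m p) {j x : V} (hj : ∀ a, a < m → j ≠ p a)
    (hjx : G.Adj j x) (hx : ∀ a, a < m → p a ≠ x ∧ ¬ G.Adj (p a) x)
    (htouch : ∃ a, a < m ∧ G.Adj j (p a)) :
    (∃ k, k + 1 < m ∧ ∀ a, a < m → (G.Adj j (p a) ↔ (a = k ∨ a = k + 1))) ∨
    (∃ e, e < m ∧ (e = 0 ∨ e + 1 = m) ∧ ∀ b, b < m → (G.Adj j (p b) ↔ b = e)) := by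
  classical
  obtain ⟨hinj, hadj⟩ := hp
  have hclose : ∀ a b, a < b → b < m → G.Adj j (p a) → G.Adj j (p b) → b = a + 1 := by
    intro a b hab hb ha' hb'
    by_contra hne
    have ham : a < m := hab.trans hb
    refine hG ⟨j, p a, p b, x, fun h => hab.ne (hinj a b ham hb h), (hx a ham).1, (hx b hb).1,
      ha', hb', hjx, fun h => ?_, (hx a ham).2, (hx b hb).2⟩
    have := (hadj a b ham hb).1 h
    omega
  obtain ⟨⟨hkm, hk⟩, hmin⟩ := And.intro (Nat.find_spec htouch) (fun b => Nat.find_min' htouch (m := b))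
  set k := Nat.find htouch
  have hnear : ∀ a, a < m → G.Adj j (p a) → a = k ∨ a = k + 1 := by
    intro a ha h
    rcases (hmin a ⟨ha, h⟩).eq_or_lt with h' | h'
    · exact Or.inl h'.symm
    · exact Or.inr (hclose k a h' ha hk h)
  by_cases hnext : k + 1 < m ∧ G.Adj j (p (k + 1))
  · refine Or.inl ⟨k, hnext.1, fun a ha => ⟨hnear a ha, ?_⟩⟩
    rintro (rfl | rfl)
    exacts [hk, hnext.2]
  · have honly : ∀ b, b < m → (G.Adj j (p b) ↔ b = k) := by
      refine fun b hb => ⟨fun h => ?_, fun h => h ▸ hk⟩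
      rcases hnear b hb h with rfl | rfl
      exacts [rfl, absurd ⟨hb, h⟩ hnext]
    refine Or.inr ⟨k, hkm, ?_, honly⟩
    by_contra! hend
    have hpred : k - 1 < m := by omega
    have hsucc : k + 1 < m := by omega
    refine hG ⟨p k, p (k - 1), p (k + 1), j, fun h => ?_, (hj _ hpred).symm, (hj _ hsucc).symm,
      (hadj _ _ hkm hpred).2 (by omega), (hadj _ _ hkm hsucc).2 (by omega), hk.symm,
      fun h => ?_, fun h => ?_, fun h => ?_⟩
    · have := hinj _ _ hpred hsucc h
      omega
    · have := (hadj _ _ hpred hsucc).1 h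
      omega
    · have := (honly _ hpred).1 h.symm
      omega
    · have := (honly _ hsucc).1 h.symm
      omega

/-- If exactly two consecutive indices below `m` satisfy `Q`, then filtering by `Q` leaves two. -/
theorem card_filter_range_eq_two {m k : ℕ} {Q : ℕ → Prop} [DecidablePred Q] (hk : k + 1 < m)
    (hQ : ∀ a, a < m → (Q a ↔ (a = k ∨ a = k + 1))) :
    ((Finset.range m).filter Q).card = 2 := by
  have : (Finset.range m).filter Q = {k, k + 1} := by
    ext a
    simp only [Finset.mem_filter, Finset.mem_range, Finset.mem_insert, Finset.mem_singleton]
    exact ⟨fun h => (hQ a h.1).1 h.2, fun h => ⟨by omega, (hQ a (by omega)).2 h⟩⟩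
  rw [this, Finset.card_pair (by omega)]

/-- If exactly one index below `m` satisfies `Q`, then filtering by `Q` leaves one. -/
theorem card_filter_range_eq_one {m e : ℕ} {Q : ℕ → Prop} [DecidablePred Q] (he : e < m)
    (hQ : ∀ a, a < m → (Q a ↔ a = e)) :
    ((Finset.range m).filter Q).card = 1 := by
  have : (Finset.range m).filter Q = {e} := by
    ext a
    simp only [Finset.mem_filter, Finset.mem_range, Finset.mem_singleton]
    exact ⟨fun h => (hQ a h.1).1 h.2, fun h => ⟨by omega, (hQ a (by omega)).2 h⟩⟩
  rw [this, Finset.card_singleton]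

/-- Mixed touch: if a vertex `j` off a family of pairwise non-adjacent induced paths
in a claw-free graph has an odd number of neighbours on the union and touches at
least two of the paths, then it touches exactly two, one in two consecutive vertices
and the other in a single endpoint. -/
theorem stmt_7 {V : Type*} [Fintype V] (G : SimpleGraph V) [DecidableRel G.Adj]
    (hG : ClawFree G) (c : ℕ) (hc : 2 ≤ c)
    (len : Fin c → ℕ) (P : Fin c → ℕ → V)
    (hpaths : ∀ i, IsInducedPath G (len i) (P i))
    (hdisj : ∀ i i', i ≠ i' → ∀ a, a < len i → ∀ b, b < len i' →
      P i a ≠ P i' b ∧ ¬ G.Adj (P i a) (P i' b))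
    (j : V) (hj : ∀ i, ∀ a, a < len i → j ≠ P i a)
    (hodd : Odd (∑ i, ((Finset.range (len i)).filter (fun a => G.Adj j (P i a))).card))
    (htwo : ∃ i i', i ≠ i' ∧ (∃ a, a < len i ∧ G.Adj j (P i a)) ∧
      (∃ b, b < len i' ∧ G.Adj j (P i' b))) :
    ∃ i₁ i₂ : Fin c, i₁ ≠ i₂ ∧
      (∀ i, (∃ a, a < len i ∧ G.Adj j (P i a)) → i = i₁ ∨ i = i₂) ∧
      (∃ k, k + 1 < len i₁ ∧
        ∀ a, a < len i₁ → (G.Adj j (P i₁ a) ↔ (a = k ∨ a = k + 1))) ∧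
      (∃ e, e < len i₂ ∧ (e = 0 ∨ e + 1 = len i₂) ∧
        ∀ b, b < len i₂ → (G.Adj j (P i₂ b) ↔ b = e)) := by
  obtain ⟨i, i', hne, ⟨a, ha, hja⟩, b, hb, hjb⟩ := htwo
  have honly : ∀ l, (∃ d, d < len l ∧ G.Adj j (P l d)) → l = i ∨ l = i' := by
    rintro l ⟨d, hd, hjd⟩
    by_contra! hl
    have h₁ := hdisj i i' hne a ha b hb
    have h₂ := hdisj i l hl.1.symm a ha d hd
    have h₃ := hdisj i' l hl.2.symm b hb d hd
    exact hG ⟨j, P i a, P i' b, P l d, h₁.1, h₂.1, h₃.1, hja, hjb, hjd, h₁.2, h₂.2, h₃.2⟩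
  rw [Finset.sum_eq_add_of_mem i i' (Finset.mem_univ _) (Finset.mem_univ _) hne] at hodd
  swap
  · rintro l - ⟨hl, hl'⟩
    rw [Finset.card_eq_zero, Finset.filter_eq_empty_iff]
    intro d hd hjd
    exact (honly l ⟨d, Finset.mem_range.1 hd, hjd⟩).elim hl hl'
  rcases hG.neighbors_on_inducedPath (hpaths i) (hj i) hjb
      (fun d hd => hdisj i i' hne d hd b hb) ⟨a, ha, hja⟩ with h | h <;>
    rcases hG.neighbors_on_inducedPath (hpaths i') (hj i') hja
      (fun d hd => hdisj i' i hne.symm d hd a ha) ⟨b, hb, hjb⟩ with h' | h'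
  · obtain ⟨k, hk, hQ⟩ := h
    obtain ⟨k', hk', hQ'⟩ := h'
    rw [card_filter_range_eq_two hk hQ, card_filter_range_eq_two hk' hQ'] at hodd
    exact absurd hodd (by decide)
  · exact ⟨i, i', hne, honly, h, h'⟩
  · exact ⟨i', i, hne.symm, fun l hl => (honly l hl).symm, h', h⟩
  · obtain ⟨e, he, -, hQ⟩ := h
    obtain ⟨e', he', -, hQ'⟩ := h'
    rw [card_filter_range_eq_one he hQ, card_filter_range_eq_one he' hQ'] at hodd
    exact absurd hodd (by decide)
end

section
/- Let G be a finite simple graph with vertex weights b_v ∈ ℝ, and let K be a clique of G. Then the weighted independence polynomials satisfy the recursion P_G(x) = P_{G∖K}(x) − x · Σ_{v∈K} b_v² · P_{G∖Γ[v]}(x), where G∖S denotes the induced subgraph on the vertices outside S with the restricted weights, and Γ[v] is the closed neighborhood of v. -/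
/-- The weighted independence polynomial of the induced subgraph of `G` on the vertex
set `A`, with weights `b`: `P(x) = Σ_{S ⊆ A independent} (-x)^|S| ∏_{v ∈ S} (b v)²`. -/
noncomputable def indepPoly {V : Type*} [DecidableEq V] (G : SimpleGraph V)
    [DecidableRel G.Adj] (b : V → ℝ) (A : Finset V) (x : ℝ) : ℝ :=
  ∑ S ∈ A.powerset.filter (fun S => ∀ u ∈ S, ∀ v ∈ S, u ≠ v → ¬ G.Adj u v),
    (-x) ^ S.card * ∏ v ∈ S, (b v) ^ 2

/-- Vertex recursion of the weighted independence polynomial. -/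
theorem indepPoly_insert {V : Type*} [DecidableEq V] (G : SimpleGraph V)
    [DecidableRel G.Adj] (b : V → ℝ) {A : Finset V} {w : V} (hw : w ∉ A) (x : ℝ) :
    indepPoly G b (insert w A) x
      = indepPoly G b A x - x * ((b w) ^ 2 *
          indepPoly G b (A.filter (fun u => ¬ (u = w ∨ G.Adj u w))) x) := by
  have hfilter : A.powerset.filter
        (fun S => ∀ u ∈ (insert w S : Finset V), ∀ v ∈ (insert w S : Finset V),
          u ≠ v → ¬ G.Adj u v)
      = (A.filter (fun u => ¬ (u = w ∨ G.Adj u w))).powerset.filter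
        (fun S => ∀ u ∈ S, ∀ v ∈ S, u ≠ v → ¬ G.Adj u v) := by
    ext S
    simp only [Finset.mem_filter, Finset.mem_powerset, Finset.mem_insert, Finset.subset_iff,
      not_or]
    constructor
    · rintro ⟨hSA, hS⟩
      refine ⟨fun u hu => ⟨hSA hu, ?_⟩, fun u hu v hv => hS u (.inr hu) v (.inr hv)⟩
      have huw : u ≠ w := fun h => hw (h ▸ hSA hu)
      exact ⟨huw, hS u (.inr hu) w (.inl rfl) huw⟩
    · rintro ⟨hSA, hS⟩
      refine ⟨fun u hu => (hSA hu).1, ?_⟩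
      rintro u (rfl | hu) v (rfl | hv) huv
      · exact absurd rfl huv
      · exact fun h => (hSA hv).2.2 h.symm
      · exact fun h => (hSA hu).2.2 h
      · exact hS u hu v hv huv
  unfold indepPoly
  rw [← hfilter]
  simp only [Finset.sum_filter]
  rw [Finset.sum_powerset_insert hw, sub_eq_add_neg, Finset.mul_sum, Finset.mul_sum,
    ← Finset.sum_neg_distrib]
  congr 1
  refine Finset.sum_congr rfl fun S hS => ?_
  have hwS : w ∉ S := fun h => hw (Finset.mem_powerset.1 hS h)
  rw [Finset.card_insert_of_notMem hwS, Finset.prod_insert hwS]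
  split_ifs <;> ring

/-- Clique recursion of the weighted independence polynomial:
`P_G(x) = P_{G∖K}(x) - x Σ_{v∈K} b_v² P_{G∖Γ[v]}(x)` for every clique `K`. -/
theorem stmt_8 {V : Type*} [Fintype V] [DecidableEq V] (G : SimpleGraph V)
    [DecidableRel G.Adj] (b : V → ℝ)
    (K : Finset V) (hK : ∀ u ∈ K, ∀ v ∈ K, u ≠ v → G.Adj u v) (x : ℝ) :
    indepPoly G b Finset.univ x
      = indepPoly G b (Finset.univ \ K) x
        - x * ∑ v ∈ K, (b v) ^ 2 *
            indepPoly G b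
              (Finset.univ \ Finset.univ.filter (fun u => u = v ∨ G.Adj u v)) x := by
  induction K using Finset.induction_on with
  | empty => simp
  | insert w K hw ih =>
    have hinsert : Finset.univ \ K = insert w (Finset.univ \ insert w K) := by grind
    have hdiff : (Finset.univ \ insert w K).filter (fun u => ¬ (u = w ∨ G.Adj u w))
        = Finset.univ \ Finset.univ.filter (fun u => u = w ∨ G.Adj u w) := by
      ext u
      simp only [Finset.mem_sdiff, Finset.mem_univ, Finset.mem_filter, true_and,
        and_iff_right_iff_imp]
      intro hu huK
      by_cases huw : u = w
      · exact hu (.inl huw)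
      · exact hu (.inr (hK u huK w (Finset.mem_insert_self w K) huw))
    rw [ih fun u hu v hv => hK u (Finset.mem_insert_of_mem hu) v (Finset.mem_insert_of_mem hv),
      hinsert, indepPoly_insert G b (by simp) x, hdiff, Finset.sum_insert hw]
    ring
end

section
/- Let G be a connected finite simple graph that is even-hole-free and claw-free, with vertex weights b_v ∈ ℝ∖{0}, and let K_s be a simplicial clique of G. Let x₀ > 0 be a real number with P_G(x₀) = 0, P′_G(x₀) ≠ 0 (a simple root) and P_{G∖K_s}(x₀) ≠ 0. Then −x₀ · P_{G∖K_s}(x₀) · P′_G(x₀) > 0. -/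
/-- A finset of vertices is a clique. -/
def IsClique {V : Type*} (G : SimpleGraph V) (K : Finset V) : Prop :=
  ∀ u ∈ K, ∀ v ∈ K, u ≠ v → G.Adj u v

/-- A clique `K` is simplicial if for every `v ∈ K` the set `Γ[v] ∖ K` is a clique. -/
def IsSimplicialClique {V : Type*} (G : SimpleGraph V) (K : Finset V) : Prop :=
  IsClique G K ∧
  ∀ v ∈ K, ∀ u u' : V, (u = v ∨ G.Adj u v) → u ∉ K → (u' = v ∨ G.Adj u' v) → u' ∉ K →
    u ≠ u' → G.Adj u u'

/-- The extended graph `G_χ`: a new vertex `χ` (represented by `none`) is adjacent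
exactly to the vertices of `K`. -/
def extGraph {V : Type*} (G : SimpleGraph V) (K : Finset V) : SimpleGraph (Option V) :=
  SimpleGraph.fromRel (fun x y =>
    (∃ u v : V, x = some u ∧ y = some v ∧ G.Adj u v) ∨
    (∃ v : V, x = none ∧ y = some v ∧ v ∈ K))

/-- The list `l = [ℓ₁, …, ℓ_n]` encodes the rooted path `χ – ℓ₁ – ⋯ – ℓ_n`:
this predicate says that this sequence is an induced path in the extended graph. -/
def IsRootedPath {V : Type*} (G : SimpleGraph V) (K : Finset V) (l : List V) : Prop :=
  IsInducedPath (extGraph G K) (l.length + 1)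
    (fun a => (none :: l.map some).getD a none)

/-- The residual graph of a rooted path: the vertices of `G` outside `K` (the closed
neighborhood of `χ` in `G`) and outside the closed neighborhood of every path vertex. -/
def residualSet {V : Type*} [Fintype V] [DecidableEq V] (G : SimpleGraph V)
    [DecidableRel G.Adj] (K : Finset V) (l : List V) : Finset V :=
  Finset.univ.filter (fun x => x ∉ K ∧ ∀ w ∈ l, ¬ (x = w ∨ G.Adj x w))

section IndepPoly

variable {V : Type*} [DecidableEq V] (G : SimpleGraph V) [DecidableRel G.Adj] (b : V → ℝ)

theorem indepPoly_differentiable (A : Finset V) : Differentiable ℝ (indepPoly G b A) := by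
  unfold indepPoly
  fun_prop

/-- Deletion of a single vertex. -/
theorem indepPoly_eq_erase_sub (A : Finset V) (v : V) (hv : v ∈ A) (x : ℝ) :
    indepPoly G b A x =
      indepPoly G b (A.erase v) x -
        x * b v ^ 2 * indepPoly G b ((A.erase v).filter (fun u => ¬ G.Adj v u)) x := by
  have key : ∑ S ∈ (A.powerset.filter
        (fun S => ∀ u ∈ S, ∀ w ∈ S, u ≠ w → ¬ G.Adj u w)).filter (fun S => v ∈ S),
        (-x) ^ S.card * ∏ u ∈ S, b u ^ 2 =
      -(x * b v ^ 2 * indepPoly G b ((A.erase v).filter (fun u => ¬ G.Adj v u)) x) := by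
    rw [indepPoly, Finset.mul_sum, ← Finset.sum_neg_distrib]
    symm
    refine Finset.sum_bij' (fun S _ => insert v S) (fun S _ => S.erase v) ?_ ?_ ?_ ?_ ?_
    · intro S hS
      simp only [Finset.mem_filter, Finset.mem_powerset, Finset.subset_iff,
        Finset.mem_erase, Finset.mem_insert] at hS ⊢
      obtain ⟨h1, h2⟩ := hS
      refine ⟨⟨?_, ?_⟩, Or.inl trivial⟩
      · rintro u (rfl | hu)
        · exact hv
        · exact (h1 hu).1.2
      · rintro u (rfl | hu) w (rfl | hw) huw
        · exact absurd rfl huw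
        · exact (h1 hw).2
        · exact fun h => (h1 hu).2 h.symm
        · exact h2 u hu w hw huw
    · intro S hS
      simp only [Finset.mem_filter, Finset.mem_powerset, Finset.subset_iff,
        Finset.mem_erase] at hS ⊢
      obtain ⟨⟨h1, h2⟩, h3⟩ := hS
      exact ⟨fun u hu => ⟨⟨hu.1, h1 hu.2⟩, h2 v h3 u hu.2 (Ne.symm hu.1)⟩,
        fun u hu w hw => h2 u hu.2 w hw.2⟩
    · intro S hS
      simp only [Finset.mem_filter, Finset.mem_powerset, Finset.subset_iff,
        Finset.mem_erase] at hS
      exact Finset.erase_insert fun h => (hS.1 h).1.1 rfl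
    · intro S hS
      exact Finset.insert_erase (Finset.mem_filter.1 hS).2
    · intro S hS
      simp only [Finset.mem_filter, Finset.mem_powerset, Finset.subset_iff,
        Finset.mem_erase] at hS
      have hvS : v ∉ S := fun h => (hS.1 h).1.1 rfl
      rw [Finset.card_insert_of_notMem hvS, Finset.prod_insert hvS]
      ring
  have key' : ∑ S ∈ (A.powerset.filter
        (fun S => ∀ u ∈ S, ∀ w ∈ S, u ≠ w → ¬ G.Adj u w)).filter (fun S => v ∉ S),
        (-x) ^ S.card * ∏ u ∈ S, b u ^ 2 = indepPoly G b (A.erase v) x := by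
    rw [indepPoly]
    refine Finset.sum_congr ?_ fun _ _ => rfl
    ext S
    simp only [Finset.mem_filter, Finset.mem_powerset, Finset.subset_erase]
    tauto
  rw [sub_eq_add_neg, ← key, ← key', add_comm, indepPoly, Finset.sum_filter_add_sum_filter_not]

/-- Deletion of a clique. -/
theorem indepPoly_eq_sdiff_sub (A K : Finset V) (hKA : K ⊆ A) (hK : IsClique G K) (x : ℝ) :
    indepPoly G b A x =
      indepPoly G b (A \ K) x -
        x * ∑ k ∈ K, b k ^ 2 * indepPoly G b ((A \ K) \ (A \ K).filter (G.Adj k)) x := by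
  induction K using Finset.induction_on generalizing A with
  | empty => simp
  | insert v K hv ih =>
    have hvA : v ∈ A := hKA (Finset.mem_insert_self v K)
    have hsd : A.erase v \ K = A \ insert v K := by
      ext u
      simp only [Finset.mem_sdiff, Finset.mem_erase, Finset.mem_insert]
      tauto
    have hres : (A.erase v).filter (fun u => ¬ G.Adj v u) =
        (A \ insert v K) \ (A \ insert v K).filter (G.Adj v) := by
      ext u
      simp only [Finset.mem_sdiff, Finset.mem_erase, Finset.mem_insert, Finset.mem_filter]
      have := fun hu : u ∈ K => hK v (Finset.mem_insert_self v K) u (Finset.mem_insert_of_mem hu)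
        (fun h => hv (h ▸ hu))
      tauto
    rw [indepPoly_eq_erase_sub G b A v hvA x, hres,
      ih (A.erase v)
        (fun u hu => Finset.mem_erase.2
          ⟨fun h => hv (h ▸ hu), hKA (Finset.mem_insert_of_mem hu)⟩)
        (fun u hu w hw => hK u (Finset.mem_insert_of_mem hu) w (Finset.mem_insert_of_mem hw)),
      hsd, Finset.sum_insert hv]
    ring

theorem deriv_indepPoly_eq_sdiff_sub (A K : Finset V) (hKA : K ⊆ A) (hK : IsClique G K)
    (x : ℝ) :
    deriv (indepPoly G b A) x =
      deriv (indepPoly G b (A \ K)) x -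
        (∑ k ∈ K, b k ^ 2 * indepPoly G b ((A \ K) \ (A \ K).filter (G.Adj k)) x +
          x * ∑ k ∈ K, b k ^ 2 *
            deriv (indepPoly G b ((A \ K) \ (A \ K).filter (G.Adj k))) x) := by
  have hd := fun B => (indepPoly_differentiable G b B x).hasDerivAt
  have h := (hd (A \ K)).sub ((hasDerivAt_id x).mul
    (HasDerivAt.fun_sum (u := K) fun k _ =>
      (hd ((A \ K) \ (A \ K).filter (G.Adj k))).const_mul (b k ^ 2)))
  have h' := h.congr_of_eventuallyEq (f₁ := indepPoly G b A)
    (Filter.Eventually.of_forall fun y => indepPoly_eq_sdiff_sub G b A K hKA hK y)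
  rw [h'.deriv]
  simp

/-- `K` is a simplicial clique of the subgraph of `G` induced on `A`. -/
def IsSimplicialCliqueIn (A K : Finset V) : Prop :=
  K ⊆ A ∧ IsClique G K ∧
    ∀ v ∈ K, ∀ u ∈ A \ K, ∀ w ∈ A \ K, G.Adj v u → G.Adj v w → u ≠ w → G.Adj u w

variable {G}

/-- In a claw-free graph, the outer neighborhood of a vertex of a simplicial clique `K` is a
simplicial clique once `K` is removed. -/
theorem IsSimplicialCliqueIn.neighbors (hcf : ClawFree G) {A K : Finset V}
    (h : IsSimplicialCliqueIn G A K) {k : V} (hk : k ∈ K) :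
    IsSimplicialCliqueIn G (A \ K) ((A \ K).filter (G.Adj k)) := by
  refine ⟨Finset.filter_subset _ _, ?_, ?_⟩
  · intro u hu w hw huw
    rw [Finset.mem_filter] at hu hw
    exact h.2.2 k hk u hu.1 w hw.1 hu.2 hw.2 huw
  · intro v hv u hu w hw hvu hvw huw
    by_contra hadj
    simp only [Finset.mem_sdiff, Finset.mem_filter] at hv hu hw
    have hku : k ≠ u := fun e => hu.1.2 (e ▸ hk)
    have hkw : k ≠ w := fun e => hw.1.2 (e ▸ hk)
    exact hcf ⟨v, k, u, w, hku, hkw, huw, hv.2.symm, hvu, hvw,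
      fun e => hu.2 ⟨hu.1, e⟩, fun e => hw.2 ⟨hw.1, e⟩, hadj⟩

variable (G) in
/-- The Wronskian of the independence polynomials of the subgraphs induced on `B` and `A`. -/
noncomputable def indepPolyWronskian (B A : Finset V) (x : ℝ) : ℝ :=
  indepPoly G b B x * deriv (indepPoly G b A) x - indepPoly G b A x * deriv (indepPoly G b B) x

/-- Expansion of the Wronskian along a clique. -/
theorem indepPolyWronskian_sdiff (A K : Finset V) (hKA : K ⊆ A) (hK : IsClique G K) (x : ℝ) :
    indepPolyWronskian G b (A \ K) A x =
      -(indepPoly G b (A \ K) x *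
          ∑ k ∈ K, b k ^ 2 * indepPoly G b ((A \ K) \ (A \ K).filter (G.Adj k)) x) +
        x * ∑ k ∈ K, b k ^ 2 *
          indepPolyWronskian G b ((A \ K) \ (A \ K).filter (G.Adj k)) (A \ K) x := by
  have hsum : ∑ k ∈ K, b k ^ 2 *
      indepPolyWronskian G b ((A \ K) \ (A \ K).filter (G.Adj k)) (A \ K) x =
      (∑ k ∈ K, b k ^ 2 * indepPoly G b ((A \ K) \ (A \ K).filter (G.Adj k)) x) *
          deriv (indepPoly G b (A \ K)) x -
        indepPoly G b (A \ K) x * ∑ k ∈ K, b k ^ 2 *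
          deriv (indepPoly G b ((A \ K) \ (A \ K).filter (G.Adj k))) x := by
    rw [Finset.sum_mul, Finset.mul_sum, ← Finset.sum_sub_distrib]
    refine Finset.sum_congr rfl fun k _ => ?_
    rw [indepPolyWronskian]
    ring
  rw [hsum, indepPolyWronskian, indepPoly_eq_sdiff_sub G b A K hKA hK x,
    deriv_indepPoly_eq_sdiff_sub G b A K hKA hK x]
  ring

/-- In a claw-free graph, the Wronskian of the independence polynomials of a graph and of the
complement of a simplicial clique has constant sign. -/
theorem indepPolyWronskian_nonpos (hcf : ClawFree G) (x : ℝ) (A K : Finset V)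
    (h : IsSimplicialCliqueIn G A K) : indepPolyWronskian G b (A \ K) A x ≤ 0 := by
  induction A using Finset.strongInduction generalizing K with
  | H A ih =>
  have inner : ∀ k ∈ K,
      -(indepPoly G b (A \ K) x * indepPoly G b ((A \ K) \ (A \ K).filter (G.Adj k)) x) +
        x * indepPolyWronskian G b ((A \ K) \ (A \ K).filter (G.Adj k)) (A \ K) x ≤ 0 := by
    intro k hk
    have hL := h.neighbors hcf hk
    set B := A \ K
    set L := B.filter (G.Adj k)
    have hsub : B \ L ⊂ A :=
      Finset.sdiff_subset.trans_ssubset (Finset.sdiff_ssubset h.1 ⟨k, hk⟩)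
    have hsum := Finset.sum_nonpos fun l hl =>
      mul_nonpos_of_nonneg_of_nonpos (sq_nonneg (b l)) (ih _ hsub _ (hL.neighbors hcf hl))
    rw [indepPolyWronskian_sdiff b B L hL.1 hL.2.1 x,
      indepPoly_eq_sdiff_sub G b B L hL.1 hL.2.1 x]
    nlinarith [mul_nonneg (sq_nonneg x) (neg_nonneg.2 hsum),
      sq_nonneg (indepPoly G b (B \ L) x)]
  have hsum := Finset.sum_nonpos fun k hk =>
    mul_nonpos_of_nonneg_of_nonpos (sq_nonneg (b k)) (inner k hk)
  refine le_of_eq_of_le ?_ hsum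
  rw [indepPolyWronskian_sdiff b A K h.1 h.2.1 x, Finset.mul_sum, Finset.mul_sum,
    ← Finset.sum_neg_distrib, ← Finset.sum_add_distrib]
  refine Finset.sum_congr rfl fun k _ => ?_
  ring

end IndepPoly

/-- Positivity of the normalization radicand: at a simple positive root `x₀` of
`P_G`, with `P_{G∖K_s}(x₀) ≠ 0`, one has `-x₀ · P_{G∖K_s}(x₀) · P'_G(x₀) > 0`. -/
theorem stmt_11 {V : Type*} [Fintype V] [DecidableEq V] (G : SimpleGraph V)
    [DecidableRel G.Adj] (hconn : G.Connected)
    (hehf : EvenHoleFree G) (hcf : ClawFree G)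
    (b : V → ℝ) (hb : ∀ w, b w ≠ 0)
    (K : Finset V) (hK : IsSimplicialClique G K)
    (x₀ : ℝ) (hx₀ : 0 < x₀)
    (hroot : indepPoly G b Finset.univ x₀ = 0)
    (hsimple : deriv (indepPoly G b Finset.univ) x₀ ≠ 0)
    (hKroot : indepPoly G b (Finset.univ \ K) x₀ ≠ 0) :
    0 < -x₀ * indepPoly G b (Finset.univ \ K) x₀ *
        deriv (indepPoly G b Finset.univ) x₀ := by
  have hsimp : IsSimplicialCliqueIn G Finset.univ K := by
    refine ⟨Finset.subset_univ K, hK.1, fun v hv u hu w hw hvu hvw huw => ?_⟩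
    exact hK.2 v hv u w (Or.inr hvu.symm) (Finset.mem_sdiff.1 hu).2 (Or.inr hvw.symm)
      (Finset.mem_sdiff.1 hw).2 huw
  have h := indepPolyWronskian_nonpos b hcf x₀ Finset.univ K hsimp
  rw [indepPolyWronskian, hroot, zero_mul, sub_zero] at h
  rw [mul_assoc]
  exact mul_pos_of_neg_of_neg (neg_lt_zero.2 hx₀) (lt_of_le_of_ne h (mul_ne_zero hKroot hsimple))
end

section
/- For every integer M ≥ 6, the square of the cycle graph C_M² contains an induced cycle with exactly 2⌈M/4⌉ vertices, and every induced cycle in C_M² with an even number of vertices has at least 2⌈M/4⌉ vertices. Hence the smallest induced even hole in C_M² has size 2⌈M/4⌉, the smallest even integer not smaller than M/2. -/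
/-- The square `C_M²` of the cycle graph: vertices `ZMod M`, two distinct vertices
adjacent iff their difference is `±1` or `±2`. -/
def cycleSquare (M : ℕ) : SimpleGraph (ZMod M) :=
  SimpleGraph.fromRel (fun i j => j - i = 1 ∨ j - i = 2)

theorem cycleSquare_adj {M : ℕ} (i j : ZMod M) :
    (cycleSquare M).Adj i j ↔
      i ≠ j ∧ ((j - i = 1 ∨ j - i = 2) ∨ (i - j = 1 ∨ i - j = 2)) :=
  SimpleGraph.fromRel_adj _ _ _

/-- Adjacency in `C_M²` in terms of representatives in `[0, M)`. -/
theorem cycleSquare_adj_natCast {M x y : ℕ} (hxy : x < y) (hy : y < M) :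
    (cycleSquare M).Adj (x : ZMod M) (y : ZMod M) ↔
      y = x + 1 ∨ y = x + 2 ∨ y + 1 = x + M ∨ y + 2 = x + M := by
  have cast_sub_eq (a b d : ℤ) : ((a : ZMod M) - b = d) ↔ (M : ℤ) ∣ a - b - d := by
    rw [← ZMod.intCast_zmod_eq_zero_iff_dvd, ← sub_eq_zero]
    push_cast
    rfl
  have dvd_iff (z : ℤ) (h1 : -(M : ℤ) < z) (h2 : z < M) : (M : ℤ) ∣ z ↔ z = 0 :=
    ⟨fun h => Int.eq_zero_of_abs_lt_dvd h (abs_lt.2 ⟨h1, h2⟩), fun h => h ▸ dvd_zero _⟩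
  have ne : (x : ZMod M) ≠ y := by
    rw [Ne, ← sub_eq_zero]
    have h := cast_sub_eq x y 0
    push_cast at h
    rw [h, dvd_iff _ (by omega) (by omega)]
    omega
  have h1 := cast_sub_eq y x 1
  have h2 := cast_sub_eq y x 2
  have h3 := cast_sub_eq x y 1
  have h4 := cast_sub_eq x y 2
  push_cast at h1 h2 h3 h4
  rw [cycleSquare_adj, h1, h2, h3, h4, dvd_iff _ (by omega) (by omega),
    dvd_iff _ (by omega) (by omega), ← dvd_add_self_right, dvd_iff _ (by omega) (by omega),
    ← dvd_add_self_right (b := (x : ℤ) - y - 2), dvd_iff _ (by omega) (by omega)]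
  simp only [ne, ne_eq, not_false_eq_true, true_and]
  omega

/-- Walk around the cycle in `2k` steps of length `2`, except that `t` pairwise
non-consecutive steps have length `1`. -/
theorem isInducedCycle_cycleSquare {M k t : ℕ} (hM : M + t = 4 * k) (hk : 2 ≤ k) (ht : t ≤ k) :
    IsInducedCycle (cycleSquare M) (2 * k)
      (fun a => ((2 * a - min t (a / 2) : ℕ) : ZMod M)) := by
  have lt_of {a : ℕ} (ha : a < 2 * k) : 2 * a - min t (a / 2) < M := by omega
  have adj {a b : ℕ} (hab : a < b) (hb : b < 2 * k) :
      (cycleSquare M).Adj ((2 * a - min t (a / 2) : ℕ) : ZMod M)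
        ((2 * b - min t (b / 2) : ℕ) : ZMod M) ↔ (a + 1) % (2 * k) = b ∨ (b + 1) % (2 * k) = a := by
    rw [cycleSquare_adj_natCast (by omega) (lt_of hb), Nat.mod_eq_of_lt (by omega : a + 1 < 2 * k)]
    rcases Nat.lt_or_ge (b + 1) (2 * k) with h | h
    · rw [Nat.mod_eq_of_lt h]
      omega
    · have h' : b + 1 = 2 * k := by omega
      rw [h', Nat.mod_self]
      omega
  refine ⟨by omega, fun a b ha hb h => ?_, fun a b ha hb => ?_⟩
  · have h' := (ZMod.natCast_eq_natCast_iff' _ _ _).1 h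
    rw [Nat.mod_eq_of_lt (lt_of ha), Nat.mod_eq_of_lt (lt_of hb)] at h'
    omega
  · rcases lt_trichotomy a b with h | rfl | h
    · exact adj h hb
    · simp only [SimpleGraph.irrefl, or_self, false_iff]
      rcases Nat.lt_or_ge (a + 1) (2 * k) with h | h
      · rw [Nat.mod_eq_of_lt h]
        omega
      · rw [show a + 1 = 2 * k by omega, Nat.mod_self]
        omega
    · rw [SimpleGraph.adj_comm, adj h ha, or_comm]

/-- A hole of length at least `4` in `C_M²` winds around the cycle, hence has at least `M / 2`
vertices. -/
theorem IsInducedCycle.le_two_mul {M q : ℕ} {c : ℕ → ZMod M}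
    (hc : IsInducedCycle (cycleSquare M) q c) (hq : 4 ≤ q) : M ≤ 2 * q := by
  obtain ⟨-, inj, adj⟩ := hc
  have step (a : ℕ) : ∃ d : ℤ, (d = 1 ∨ d = 2 ∨ d = -1 ∨ d = -2) ∧
      c ((a + 1) % q) - c (a % q) = d := by
    have h := (adj (a % q) ((a + 1) % q) (Nat.mod_lt _ (by omega)) (Nat.mod_lt _ (by omega))).2
      (Or.inl (by simp))
    rw [cycleSquare_adj] at h
    rcases h.2 with (h | h) | (h | h)
    · exact ⟨1, by simp, by simpa using h⟩
    · exact ⟨2, by simp, by simpa using h⟩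
    · exact ⟨-1, by simp, by rw [← neg_sub, h]; simp⟩
    · exact ⟨-2, by simp, by rw [← neg_sub, h]; simp⟩
  choose d hd hcd using step
  have far (a : ℕ) : d a + d (a + 1) ≠ 0 ∧ d a + d (a + 1) ≠ 1 ∧ d a + d (a + 1) ≠ -1 := by
    have hlt := Nat.mod_lt a (by omega : 0 < q)
    have hlt' := Nat.mod_lt (a + 2) (by omega : 0 < q)
    have hmod : (a + 2) % q = if a % q + 2 < q then a % q + 2 else a % q + 2 - q := by
      rw [Nat.add_mod, Nat.mod_eq_of_lt (by omega : 2 < q)]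
      split_ifs with h
      · exact Nat.mod_eq_of_lt h
      · rw [Nat.mod_eq_sub_mod (by omega), Nat.mod_eq_of_lt (by omega)]
    have succ_mod {x : ℕ} (hx : x < q) : (x + 1) % q = if x + 1 < q then x + 1 else 0 := by
      split_ifs with h
      · exact Nat.mod_eq_of_lt h
      · rw [show x + 1 = q by omega, Nat.mod_self]
    have hne : c (a % q) ≠ c ((a + 2) % q) := fun h => by
      have := inj _ _ hlt hlt' h
      split_ifs at hmod <;> omega
    have hnadj : ¬ (cycleSquare M).Adj (c (a % q)) (c ((a + 2) % q)) := by
      rw [adj _ _ hlt hlt', succ_mod hlt, succ_mod hlt']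
      split_ifs at hmod ⊢ <;> omega
    have hsum : c ((a + 2) % q) - c (a % q) = ((d a + d (a + 1) : ℤ) : ZMod M) := by
      rw [Int.cast_add, ← hcd, ← hcd]
      ring
    rw [cycleSquare_adj] at hnadj
    refine ⟨fun h => hne ?_, fun h => hnadj ⟨hne, Or.inl (Or.inl ?_)⟩,
      fun h => hnadj ⟨hne, Or.inr (Or.inl ?_)⟩⟩
    · rw [h, Int.cast_zero, sub_eq_zero] at hsum
      exact hsum.symm
    · rw [hsum, h, Int.cast_one]
    · rw [← neg_sub, hsum, h]
      simp
  have total : (M : ℤ) ∣ ∑ a ∈ Finset.range q, d a := by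
    rw [← ZMod.intCast_zmod_eq_zero_iff_dvd, Int.cast_sum]
    simp_rw [← hcd]
    rw [Finset.sum_range_sub (fun a => c (a % q))]
    simp
  have bound (n : ℕ) :
      (0 < d n ∧ (n : ℤ) ≤ ∑ a ∈ Finset.range n, d a ∧ ∑ a ∈ Finset.range n, d a ≤ 2 * n) ∨
      (d n < 0 ∧ ∑ a ∈ Finset.range n, d a ≤ -n ∧ -(2 * n : ℤ) ≤ ∑ a ∈ Finset.range n, d a) := by
    induction n with
    | zero =>
      have := hd 0
      simp
      omega
    | succ n ih =>
      rw [Finset.sum_range_succ]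
      have h1 := hd n
      have h2 := hd (n + 1)
      have h3 := far n
      push_cast
      omega
  rcases bound q with h | h
  · have := Int.le_of_dvd (by omega) total
    omega
  · have := Int.le_of_dvd (by omega) ((dvd_neg).2 total)
    omega

/-- For `M ≥ 6`, the square of the cycle graph `C_M²` contains an induced cycle with
exactly `2⌈M/4⌉` vertices, and every even induced cycle in `C_M²` has at least
`2⌈M/4⌉` vertices; hence the smallest induced even hole of `C_M²` has size `2⌈M/4⌉`. -/
theorem stmt_12 (M : ℕ) (hM : 6 ≤ M) :
    (∃ c : ℕ → ZMod M, IsInducedCycle (cycleSquare M) (2 * ((M + 3) / 4)) c) ∧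
    (∀ (q : ℕ) (c : ℕ → ZMod M),
      IsInducedCycle (cycleSquare M) q c → Even q → 2 * ((M + 3) / 4) ≤ q) := by
  refine ⟨⟨_, isInducedCycle_cycleSquare (t := 4 * ((M + 3) / 4) - M)
    (by omega) (by omega) (by omega)⟩, fun q c hc hq => ?_⟩
  obtain ⟨r, rfl⟩ := hq
  have h3 := hc.1
  have := hc.le_two_mul (by omega)
  omega
end

section
/- For every integer M ≥ 5, the square of the cycle graph C_M² contains no even bubble wand (it is even-bubble-wand-free). -/
/-- A graph contains an even bubble wand if it has an induced even hole together with
a vertex-disjoint induced path with at least two vertices whose terminal vertex is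
adjacent to exactly two consecutive hole vertices and to no other hole vertex, while
every other path vertex is adjacent to no hole vertex. -/
def HasEvenBubbleWand {V : Type*} (G : SimpleGraph V) : Prop :=
  ∃ (q : ℕ) (c : ℕ → V) (p_len : ℕ) (p : ℕ → V),
    Even q ∧ IsInducedCycle G q c ∧
    2 ≤ p_len ∧ IsInducedPath G p_len p ∧
    (∀ a, a < p_len → ∀ b, b < q → p a ≠ c b) ∧
    (∃ t, t < q ∧ G.Adj (p (p_len - 1)) (c t) ∧
      G.Adj (p (p_len - 1)) (c ((t + 1) % q)) ∧
      ∀ b, b < q → G.Adj (p (p_len - 1)) (c b) → (b = t ∨ b = (t + 1) % q)) ∧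
    (∀ a, a + 1 < p_len → ∀ b, b < q → ¬ G.Adj (p a) (c b))

theorem cycleSquare_adj_iff {M : ℕ} (x y : ZMod M) :
    (cycleSquare M).Adj x y ↔
      x ≠ y ∧ ((y - x = 1 ∨ y - x = 2) ∨ (x - y = 1 ∨ x - y = 2)) := by
  simp [cycleSquare, SimpleGraph.fromRel_adj]

theorem Nat.add_one_mod_of_lt {a q : ℕ} (h : a < q) :
    (a + 1) % q = if a + 1 = q then 0 else a + 1 := by
  split_ifs with h'
  · simp [h']
  · exact Nat.mod_eq_of_lt (by omega)

theorem ZMod.val_lt_val_of_sub_eq {M : ℕ} (hM : 3 ≤ M) {x y : ZMod M}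
    (hx : x.val + 2 < M) (h : y - x = 1 ∨ y - x = 2) : x.val < y.val := by
  have : NeZero M := ⟨by omega⟩
  have key (k : ℕ) (hk : 0 < k) (hk2 : k ≤ 2) (e : y - x = (k : ZMod M)) : x.val < y.val := by
    have hy : y = x + (k : ZMod M) := by rw [← e]; ring
    rw [hy, ZMod.val_add, ZMod.val_natCast, Nat.mod_eq_of_lt (a := k) (by omega),
      Nat.mod_eq_of_lt (by omega)]
    omega
  rcases h with h | h
  · exact key 1 (by omega) (by omega) (by simpa using h)
  · exact key 2 (by omega) (by omega) (by simpa using h)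

theorem ZMod.val_sub_add_two_lt {M : ℕ} [NeZero M] {v w : ZMod M}
    (h1 : w - v ≠ 1) (h2 : w - v ≠ 2) : (v - w).val + 2 < M := by
  by_contra hlt
  have hv := ZMod.val_lt (v - w)
  have e : ((M - (v - w).val : ℕ) : ZMod M) = w - v := by
    rw [Nat.cast_sub hv.le, ZMod.natCast_self, ZMod.natCast_zmod_val]
    ring
  obtain h | h : M - (v - w).val = 1 ∨ M - (v - w).val = 2 := by omega
  · exact h1 (by rw [← e, h]; simp)
  · exact h2 (by rw [← e, h]; simp)

/-- Every hole with at least four vertices in the square of a cycle is dominating. -/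
theorem IsInducedCycle.exists_eq_or_adj_cycleSquare {M q : ℕ} (hM : 3 ≤ M) (hq : 4 ≤ q)
    {c : ℕ → ZMod M} (hc : IsInducedCycle (cycleSquare M) q c) (w : ZMod M) :
    ∃ b < q, w = c b ∨ (cycleSquare M).Adj w (c b) := by
  by_contra! hw
  have : NeZero M := ⟨by omega⟩
  obtain ⟨-, hinj, hadj⟩ := hc
  obtain ⟨t, ht, hmax⟩ := Finset.exists_max_image (Finset.range q) (fun b => (c b - w).val)
    ⟨0, Finset.mem_range.2 (by omega)⟩
  rw [Finset.mem_range] at ht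
  have hsmall : (c t - w).val + 2 < M := by
    obtain ⟨hne, hna⟩ := hw t ht
    rw [cycleSquare_adj_iff] at hna
    exact ZMod.val_sub_add_two_lt (fun h => hna ⟨hne, .inr (.inl h)⟩)
      (fun h => hna ⟨hne, .inr (.inr h)⟩)
  have below (s : ℕ) (hs : s < q) (hts : (cycleSquare M).Adj (c t) (c s)) :
      c t - c s = 1 ∨ c t - c s = 2 := by
    refine ((cycleSquare_adj_iff _ _).1 hts).2.resolve_left fun h => ?_
    have hlt := ZMod.val_lt_val_of_sub_eq hM hsmall (y := c s - w) (by simpa using h)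
    exact hlt.not_ge (hmax s (Finset.mem_range.2 hs))
  obtain ⟨s, r, hs, hr, hsr, hts, htr, hns, hnr⟩ : ∃ s r, s < q ∧ r < q ∧ s ≠ r ∧
      (t + 1) % q = s ∧ (r + 1) % q = t ∧ (s + 1) % q ≠ r ∧ (r + 1) % q ≠ s := by
    refine ⟨if t + 1 = q then 0 else t + 1, if t = 0 then q - 1 else t - 1, ?_⟩
    have hs : (if t + 1 = q then 0 else t + 1) < q := by split_ifs <;> omega
    have hr : (if t = 0 then q - 1 else t - 1) < q := by split_ifs <;> omega
    rw [Nat.add_one_mod_of_lt ht, Nat.add_one_mod_of_lt hs, Nat.add_one_mod_of_lt hr]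
    refine ⟨hs, hr, ?_, rfl, ?_, ?_, ?_⟩ <;> split_ifs <;> omega
  have hnadj : ¬ (cycleSquare M).Adj (c s) (c r) := by
    rw [hadj s r hs hr]
    tauto
  have hne : c s ≠ c r := fun h => hsr (hinj s r hs hr h)
  refine hnadj ((cycleSquare_adj_iff _ _).2 ⟨hne, ?_⟩)
  rcases below s hs ((hadj t s ht hs).2 (.inl hts)) with h1 | h1 <;>
    rcases below r hr ((hadj t r ht hr).2 (.inr htr)) with h2 | h2
  · exact absurd (by linear_combination h2 - h1) hne
  · exact .inr (.inl (by linear_combination h2 - h1))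
  · exact .inl (.inl (by linear_combination h1 - h2))
  · exact absurd (by linear_combination h2 - h1) hne

/-- For every `M ≥ 5`, the square of the cycle graph `C_M²` is even-bubble-wand-free. -/
theorem stmt_13 (M : ℕ) (hM : 5 ≤ M) : ¬ HasEvenBubbleWand (cycleSquare M) := by
  rintro ⟨q, c, n, p, hq, hc, hn, -, hdisj, -, hfar⟩
  have hq3 := hc.1
  obtain ⟨k, hk⟩ := hq
  obtain ⟨b, hb, h⟩ := hc.exists_eq_or_adj_cycleSquare (by omega) (by omega) (p (n - 2))
  exact h.elim (hdisj (n - 2) (by omega) b hb) (hfar (n - 2) (by omega) b hb)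
end

section
/- For every integer M ≥ 5, the clockwise orientation of C_M² is an induced-path orientation: for every induced three-vertex path i–j–ℓ in C_M² (distinct vertices with i adjacent to j, j adjacent to ℓ, and i not adjacent to ℓ), either both j − i and ℓ − j lie in {1, 2} in ℤ/Mℤ, or both i − j and j − ℓ lie in {1, 2} in ℤ/Mℤ. -/
/-- The clockwise orientation of `C_M²` is an induced-path orientation: on every
induced three-vertex path `i – j – ℓ`, either both edges point clockwise
(differences in `{1, 2}`) or both point counter-clockwise. -/
theorem stmt_14 (M : ℕ) (hM : 5 ≤ M) (i j ℓ : ZMod M)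
    (hij : (cycleSquare M).Adj i j) (hjl : (cycleSquare M).Adj j ℓ)
    (hil : i ≠ ℓ) (hnadj : ¬ (cycleSquare M).Adj i ℓ) :
    ((j - i = 1 ∨ j - i = 2) ∧ (ℓ - j = 1 ∨ ℓ - j = 2)) ∨
    ((i - j = 1 ∨ i - j = 2) ∧ (j - ℓ = 1 ∨ j - ℓ = 2)) := by
  simp only [cycleSquare, SimpleGraph.fromRel_adj] at hij hjl hnadj
  obtain ⟨-, hij⟩ := hij
  obtain ⟨-, hjl⟩ := hjl
  rw [not_and] at hnadj
  have hnear := hnadj hil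
  rcases hij with hij | hij <;> rcases hjl with hjl | hjl
  · exact Or.inl ⟨hij, hjl⟩
  · exfalso
    rcases hij with h | h <;> rcases hjl with h' | h'
    · exact hil (by linear_combination h' - h)
    · exact hnear (Or.inr (Or.inl (by linear_combination h' - h)))
    · exact hnear (Or.inl (Or.inl (by linear_combination h - h')))
    · exact hil (by linear_combination h' - h)
  · exfalso
    rcases hij with h | h <;> rcases hjl with h' | h'
    · exact hil (by linear_combination h - h')
    · exact hnear (Or.inl (Or.inl (by linear_combination h' - h)))
    · exact hnear (Or.inr (Or.inl (by linear_combination h - h')))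
    · exact hil (by linear_combination h - h')
  · exact Or.inr ⟨hij, hjl⟩
end

section
/- Let 𝒞_{a,b} = C(a+b, b) − C(a+b, b−1) denote the Catalan-triangle numbers, with the convention C(n, −1) = 0. Then for all natural numbers A and n and every integer m ≥ 1: C(A+2n+m, n) = Σ_{j=0}^{n} C(A+2j, j) · 𝒞_{n−j+m−1, n−j}. -/
/-- The Catalan-triangle numbers `𝒞_{a,b} = C(a+b, b) − C(a+b, b−1)`, with the
convention `C(n, −1) = 0`. -/
def catalanTriangle (a b : ℕ) : ℤ :=
  ((a + b).choose b : ℤ) - (if b = 0 then 0 else ((a + b).choose (b - 1) : ℤ))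

@[simp]
theorem catalanTriangle_zero_right (a : ℕ) : catalanTriangle a 0 = 1 := by
  simp [catalanTriangle]

theorem catalanTriangle_succ_succ (a b : ℕ) :
    catalanTriangle (a + 1) (b + 1) = catalanTriangle a (b + 1) + catalanTriangle (a + 1) b := by
  have h₁ : a + 1 + (b + 1) = a + b + 1 + 1 := by ring
  have h₂ : a + (b + 1) = a + b + 1 := by ring
  have h₃ : a + 1 + b = a + b + 1 := by ring
  cases b with
  | zero =>
    simp [catalanTriangle]
  | succ b =>
    simp only [catalanTriangle, h₁, h₂, h₃, Nat.add_one_ne_zero, if_false, Nat.add_sub_cancel,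
      Nat.choose_succ_succ' (a + (b + 1) + 1)]
    push_cast
    ring

@[simp]
theorem catalanTriangle_self_succ (b : ℕ) : catalanTriangle b (b + 1) = 0 := by
  have h : (b + (b + 1)).choose (b + 1) = (b + (b + 1)).choose b :=
    Nat.choose_symm_add.symm
  simp [catalanTriangle, h]

/-- The convolution identity, including the case `m = 0`, where truncated subtraction makes every
summand other than `j = n` vanish. -/
theorem sum_choose_mul_catalanTriangle (A n m : ℕ) :
    ∑ j ∈ Finset.range (n + 1),
        ((A + 2 * j).choose j : ℤ) * catalanTriangle (n - j + m - 1) (n - j)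
      = ((A + 2 * n + m).choose n : ℤ) := by
  induction n generalizing m with
  | zero => simp
  | succ n ihn =>
    induction m with
    | zero =>
      rw [Finset.sum_range_succ, Finset.sum_eq_zero]
      · simp
      · intro j hj
        obtain ⟨k, rfl⟩ := Nat.exists_eq_add_of_le (Finset.mem_range_succ_iff.mp hj)
        simp [show j + k + 1 - j = k + 1 by lia]
    | succ m ihm =>
      have h : A + 2 * (n + 1) + (m + 1) = A + 2 * n + (m + 2) + 1 := by ring
      have h' : A + 2 * (n + 1) + m = A + 2 * n + (m + 2) := by ring
      rw [h, Nat.choose_succ_succ', Nat.cast_add, ← ihn (m + 2), ← h', ← ihm,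
        Finset.sum_range_succ, Finset.sum_range_succ _ (n + 1), ← add_assoc (Finset.sum _ _),
        ← Finset.sum_add_distrib]
      congr 1
      · refine Finset.sum_congr rfl fun j hj => ?_
        obtain ⟨k, rfl⟩ := Nat.exists_eq_add_of_le (Finset.mem_range_succ_iff.mp hj)
        rw [show j + k + 1 - j = k + 1 by lia, show j + k - j = k by lia,
          show k + 1 + (m + 1) - 1 = k + m + 1 by lia, show k + 1 + m - 1 = k + m by lia,
          show k + (m + 2) - 1 = k + m + 1 by lia, catalanTriangle_succ_succ]
        ring
      · simp

/-- The ballot/Catalan-triangle convolution identity: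
`C(A+2n+m, n) = Σ_{j=0}^{n} C(A+2j, j) · 𝒞_{n−j+m−1, n−j}` for `m ≥ 1`. -/
theorem stmt_15 (A n m : ℕ) (hm : 1 ≤ m) :
    ((A + 2 * n + m).choose n : ℤ)
      = ∑ j ∈ Finset.range (n + 1),
          ((A + 2 * j).choose j : ℤ) * catalanTriangle (n - j + m - 1) (n - j) := by
  exact (sum_choose_mul_catalanTriangle A n m).symm
end

section
/- For all natural numbers u and j: Σ over all (u+1)-tuples (j₁, …, j_u, k) of natural numbers with j₁ + ⋯ + j_u + k = j of catalan(j₁) ⋯ catalan(j_u) · C(2k, k) equals C(u + 2j, j). Equivalently, the j-th coefficient of the formal power series Cat(z)^u · D(z), where Cat(z) = Σ_n catalan(n) z^n is the Catalan generating series and D(z) = Σ_k C(2k,k) z^k is the central binomial generating series, equals C(u+2j, j). -/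
open PowerSeries

/-- Peeling off the first entry of a tuple in a sum over tuples with prescribed total. -/
theorem Finset.Nat.sum_antidiagonalTuple_succ {M : Type*} [AddCommMonoid M] (k n : ℕ)
    (f : (Fin (k + 1) → ℕ) → M) :
    ∑ t ∈ antidiagonalTuple (k + 1) n, f t =
      ∑ p ∈ antidiagonal n, ∑ t ∈ antidiagonalTuple k p.2, f (Fin.cons p.1 t) := by
  rw [Finset.sum_sigma']
  refine Finset.sum_nbij' (fun t ↦ ⟨(t 0, ∑ i, Fin.tail t i), Fin.tail t⟩)
    (fun x ↦ Fin.cons x.1.1 x.2) ?_ ?_ ?_ ?_ ?_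
  · intro t ht
    rw [mem_antidiagonalTuple, Fin.sum_univ_succ] at ht
    simpa [mem_antidiagonalTuple, Fin.tail] using ht
  · rintro ⟨⟨a, b⟩, t⟩ h
    simp only [mem_sigma, HasAntidiagonal.mem_antidiagonal, mem_antidiagonalTuple] at h
    simp [mem_antidiagonalTuple, Fin.sum_univ_succ, h]
  · intro t _
    simp
  · rintro ⟨⟨a, b⟩, t⟩ h
    simp only [mem_sigma, HasAntidiagonal.mem_antidiagonal, mem_antidiagonalTuple] at h
    simp [h]
  · intro t _
    simp

/-- The generating series `∑ j, C(u + 2j, j) z ^ j`. -/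
def shiftedCentralSeries (u : ℕ) : ℤ⟦X⟧ :=
  mk fun j ↦ ((u + 2 * j).choose j : ℤ)

theorem shiftedCentralSeries_succ (u : ℕ) :
    shiftedCentralSeries (u + 1) =
      shiftedCentralSeries u + X * shiftedCentralSeries (u + 2) := by
  ext j
  cases j with
  | zero => simp [shiftedCentralSeries]
  | succ j =>
    rw [map_add, coeff_succ_X_mul]
    simp only [shiftedCentralSeries, coeff_mk]
    rw [show u + 1 + 2 * (j + 1) = (u + 2 + 2 * j) + 1 by ring, Nat.choose_succ_succ',
      show u + 2 * (j + 1) = u + 2 + 2 * j by ring]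
    push_cast
    ring

theorem shiftedCentralSeries_zero :
    shiftedCentralSeries 0 = 1 + 2 * (X * shiftedCentralSeries 1) := by
  ext j
  cases j with
  | zero => simp [shiftedCentralSeries]
  | succ j =>
    have h : (2 * (j + 1)).choose (j + 1) = 2 * (1 + 2 * j).choose j := by
      rw [show 2 * (j + 1) = (1 + 2 * j) + 1 by ring, Nat.choose_succ_succ',
        Nat.choose_symm_of_eq_add (show 1 + 2 * j = (j + 1) + j by ring)]
      ring
    rw [two_mul (X * _), map_add, map_add, coeff_succ_X_mul, coeff_one]
    simp only [shiftedCentralSeries, coeff_mk, zero_add, h]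
    simp [two_mul]

/-- The Catalan generating series with integer coefficients. -/
noncomputable def intCatalanSeries : ℤ⟦X⟧ :=
  map (Nat.castRingHom ℤ) catalanSeries

theorem intCatalanSeries_eq : intCatalanSeries ^ 2 * X + 1 = intCatalanSeries := by
  simpa [intCatalanSeries] using
    congrArg (map (Nat.castRingHom ℤ)) catalanSeries_sq_mul_X_add_one

theorem derivative_X_mul_intCatalanSeries :
    derivative ℤ (X * intCatalanSeries) = shiftedCentralSeries 0 := by
  ext n
  rw [coeff_derivative, coeff_succ_X_mul]
  simp only [intCatalanSeries, coeff_map, catalanSeries_coeff, shiftedCentralSeries, coeff_mk,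
    zero_add, ← Nat.centralBinom_eq_two_mul_choose, ← succ_mul_catalan_eq_centralBinom]
  push_cast
  simp [mul_comm]

theorem shiftedCentralSeries_zero_eq_one_add :
    shiftedCentralSeries 0 =
      1 + 2 * (X * (intCatalanSeries * shiftedCentralSeries 0)) := by
  have h : X * intCatalanSeries = X + (X * intCatalanSeries) ^ 2 := by
    linear_combination (-X) * intCatalanSeries_eq
  have hd := congrArg (derivative ℤ) h
  rw [map_add, sq, Derivation.leibniz _ (X * _), derivative_X_mul_intCatalanSeries, derivative_X,
    smul_eq_mul] at hd
  linear_combination hd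

theorem intCatalanSeries_mul_shiftedCentralSeries (u : ℕ) :
    intCatalanSeries * shiftedCentralSeries u = shiftedCentralSeries (u + 1) := by
  induction u with
  | zero =>
    have h := shiftedCentralSeries_zero_eq_one_add.symm.trans shiftedCentralSeries_zero
    have two_ne : (2 : ℤ⟦X⟧) ≠ 0 := fun h ↦ by
      simpa [map_ofNat constantCoeff 2] using congrArg constantCoeff h
    exact mul_left_cancel₀ X_ne_zero (mul_left_cancel₀ two_ne (add_left_cancel h))
  | succ u ih =>
    refine mul_left_cancel₀ (X_ne_zero (R := ℤ)) ?_
    linear_combination shiftedCentralSeries_succ u + (1 - X * intCatalanSeries) * ih +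
      shiftedCentralSeries u * intCatalanSeries_eq

theorem sum_catalan_mul_choose (u j : ℕ) :
    ∑ p ∈ Finset.HasAntidiagonal.antidiagonal j, catalan p.1 * (u + 2 * p.2).choose p.2 =
      (u + 1 + 2 * j).choose j := by
  have h := congrArg (coeff j) (intCatalanSeries_mul_shiftedCentralSeries u)
  simp only [coeff_mul, intCatalanSeries, shiftedCentralSeries, coeff_map, coeff_mk,
    catalanSeries_coeff, Nat.coe_castRingHom] at h
  exact_mod_cast h

/-- Coefficient identity for `Cat(z)^u · D(z)` where `Cat` is the Catalan generating
series and `D` the central-binomial generating series: summing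
`catalan(j₁)⋯catalan(j_u) · C(2k, k)` over all `(u+1)`-tuples `(j₁, …, j_u, k)` with
`j₁ + ⋯ + j_u + k = j` gives `C(u + 2j, j)`. -/
theorem stmt_16 (u j : ℕ) :
    ∑ t ∈ Finset.Nat.antidiagonalTuple (u + 1) j,
        (∏ i : Fin u, catalan (t i.castSucc)) *
          Nat.choose (2 * t (Fin.last u)) (t (Fin.last u))
      = Nat.choose (u + 2 * j) j := by
  induction u generalizing j with
  | zero => simp
  | succ u ih =>
    rw [Finset.Nat.sum_antidiagonalTuple_succ, ← sum_catalan_mul_choose]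
    refine Finset.sum_congr rfl fun p _ ↦ ?_
    rw [← ih, Finset.mul_sum]
    refine Finset.sum_congr rfl fun t _ ↦ ?_
    rw [Fin.prod_univ_succ, ← Fin.succ_last]
    simp only [Fin.castSucc_zero, Fin.cons_zero, Fin.castSucc_succ, Fin.cons_succ, mul_assoc]
end

section
/- For every integer m ≥ 1 and every natural number r: Σ over all m-tuples (r₁, …, r_m) of natural numbers with r₁ + ⋯ + r_m = r of catalan(r₁) ⋯ catalan(r_m) equals C(2r+m−1, r) − C(2r+m−1, r−1), where the subtracted term is 0 when r = 0. That is, the r-th coefficient of the m-th power of the Catalan generating series equals the Catalan-triangle number 𝒞_{r+m−1, r}. -/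
namespace PowerSeries

theorem coeff_pow_eq_sum_antidiagonalTuple {R : Type*} [CommSemiring R] (φ : PowerSeries R)
    (m r : ℕ) :
    coeff r (φ ^ m) = ∑ t ∈ Finset.Nat.antidiagonalTuple m r, ∏ i, coeff (t i) φ := by
  have h : φ ^ m = ∏ _i : Fin m, φ := by simp
  rw [h, coeff_prod]
  refine Finset.sum_equiv Finsupp.equivFunOnFinite (fun l => ?_) (fun l _ => rfl)
  simp [Finset.Nat.mem_antidiagonalTuple]

theorem catalanSeries_pow_succ (m : ℕ) :
    catalanSeries ^ (m + 1) = catalanSeries ^ m + catalanSeries ^ (m + 2) * X :=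
  calc catalanSeries ^ (m + 1)
      = catalanSeries ^ m * (catalanSeries ^ 2 * X + 1) := by
        rw [catalanSeries_sq_mul_X_add_one, pow_succ]
    _ = catalanSeries ^ m + catalanSeries ^ (m + 2) * X := by ring

theorem coeff_zero_catalanSeries_pow (m : ℕ) : coeff 0 (catalanSeries ^ m) = 1 := by
  simp

/-- The coefficients of the powers of the Catalan series are the Catalan-triangle numbers. -/
theorem coeff_succ_catalanSeries_pow_add_choose (m r : ℕ) :
    coeff (r + 1) (catalanSeries ^ m) + (2 * r + m + 1).choose r
      = (2 * r + m + 1).choose (r + 1) := by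
  induction r generalizing m with
  | zero =>
    induction m with
    | zero => simp [coeff_one]
    | succ m ih =>
      rw [catalanSeries_pow_succ, map_add, coeff_succ_mul_X, coeff_zero_catalanSeries_pow]
      simp only [Nat.choose_zero_right, zero_add, Nat.choose_one_right, mul_zero] at ih ⊢
      omega
  | succ r ihr =>
    induction m with
    | zero =>
      have h := Nat.choose_symm_of_eq_add (n := 2 * (r + 1) + 0 + 1) (a := r + 1) (b := r + 1 + 1)
        (by omega)
      simp [coeff_one, h]
    | succ m ih =>
      have h := ihr (m + 2)
      rw [catalanSeries_pow_succ, map_add, coeff_succ_mul_X]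
      rw [show 2 * r + (m + 2) + 1 = 2 * (r + 1) + m + 1 by ring] at h
      rw [show 2 * (r + 1) + (m + 1) + 1 = 2 * (r + 1) + m + 1 + 1 by ring,
        Nat.choose_succ_succ' _ r, Nat.choose_succ_succ' _ (r + 1)]
      omega

end PowerSeries

/-- Catalan convolution identity: the sum of `catalan(r₁)⋯catalan(r_m)` over all
`m`-tuples of natural numbers with `r₁ + ⋯ + r_m = r` equals the Catalan-triangle
number `𝒞_{r+m−1, r} = C(2r+m−1, r) − C(2r+m−1, r−1)` (the subtracted term being `0`
when `r = 0`). -/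
theorem stmt_17 (m : ℕ) (hm : 1 ≤ m) (r : ℕ) :
    ((∑ t ∈ Finset.Nat.antidiagonalTuple m r, ∏ i, catalan (t i) : ℕ) : ℤ)
      = ((2 * r + m - 1).choose r : ℤ)
        - (if r = 0 then 0 else ((2 * r + m - 1).choose (r - 1) : ℤ)) := by
  have hsum : ∑ t ∈ Finset.Nat.antidiagonalTuple m r, ∏ i, catalan (t i)
      = PowerSeries.coeff r (PowerSeries.catalanSeries ^ m) := by
    simp [PowerSeries.coeff_pow_eq_sum_antidiagonalTuple]
  rw [hsum]
  cases r with
  | zero => simp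
  | succ r =>
    rw [if_neg r.succ_ne_zero, show 2 * (r + 1) + m - 1 = 2 * r + m + 1 by omega,
      Nat.add_sub_cancel, eq_sub_iff_add_eq]
    exact_mod_cast PowerSeries.coeff_succ_catalanSeries_pow_add_choose m r
end
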